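/- arXiv:0812.2656 — 5 statements merged into one kernel-verified Lean document; each statement's English description precedes it below -/
import Mathlib

section
/- Fix p = 1/n. Let κ be a bounded kernel, let k ≥ 2 be a fixed integer, and let G_n = G_{1/n}(n,κ). Then for each n there is a (deterministic) nonempty compact set Y_n ⊆ ℝ^{k(k+1)/2} such that the Hausdorff distance d_H(M_k(G_n), Y_n) converges to 0 in probability as n → ∞. -/
open MeasureTheory Set Filter

noncomputable section
open scoped Classical

/-- Given the vertex types `x : Fin n → ℝ`, the conditional probability that the random
graph `G_{1/n}(n,κ)` equals `G`: each pair `{i,j}` is an edge independently with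
probability `min{κ(x_i,x_j)/n, 1}`. -/
def condProb (κ : ℝ → ℝ → ℝ) (n : ℕ) (x : Fin n → ℝ) (G : SimpleGraph (Fin n)) : ℝ :=
  ∏ q ∈ Finset.univ.filter (fun q : Fin n × Fin n => q.1 < q.2),
    if G.Adj q.1 q.2 then min (κ (x q.1) (x q.2) / n) 1
    else 1 - min (κ (x q.1) (x q.2) / n) 1

/-- The cube `[0,1]ⁿ`, over which the i.i.d. uniform types are integrated. -/
def typeCube (n : ℕ) : Set (Fin n → ℝ) := Set.univ.pi fun _ => Set.Icc (0:ℝ) 1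

/-- The probability that the random graph `G_{1/n}(n,κ)` lies in a set `A` of graphs. -/
def gProb (κ : ℝ → ℝ → ℝ) (n : ℕ) (A : Set (SimpleGraph (Fin n))) : ℝ :=
  ∫ x in typeCube n,
    ∑ G ∈ Finset.univ.filter (fun G : SimpleGraph (Fin n) => G ∈ A), condProb κ n x G

/-- `e_G(S,T)`: the number of ordered pairs `(s,t) ∈ S × T` with `st` an edge of `G`. -/
def pairCount {n : ℕ} (G : SimpleGraph (Fin n)) (S T : Set (Fin n)) : ℕ :=
  Nat.card {p : Fin n × Fin n // p.1 ∈ S ∧ p.2 ∈ T ∧ G.Adj p.1 p.2}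

/-- `P : Fin n → Fin k` describes a balanced partition of `Fin n` into `k` nonempty
parts: the part sizes differ by at most `1`. -/
def IsBalanced {n k : ℕ} (P : Fin n → Fin k) : Prop :=
  (∀ i : Fin k, (P ⁻¹' {i}).Nonempty) ∧
    ∀ i j : Fin k, ((P ⁻¹' {i}).ncard : ℤ) - ((P ⁻¹' {j}).ncard : ℤ) ≤ 1

/-- Index set for the upper triangle of a symmetric `k × k` matrix, so that
`SymIdx k → ℝ` is a copy of `ℝ^{k(k+1)/2}` (with the `ℓ∞` metric). -/
def SymIdx (k : ℕ) := {q : Fin k × Fin k // q.1 ≤ q.2}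

instance (k : ℕ) : Fintype (SymIdx k) := by unfold SymIdx; infer_instance

/-- The density matrix `M_Π(G) = (d_p(P_i,P_j))_{i ≤ j} ∈ ℝ^{k(k+1)/2}` of a partition,
where `d_p(U,W) = n·e(U,W)/(|U||W|)` (normalization `p = 1/n`). -/
def partMatrix {n k : ℕ} (G : SimpleGraph (Fin n)) (P : Fin n → Fin k) : SymIdx k → ℝ :=
  fun q => (n : ℝ) * (pairCount G (P ⁻¹' {q.val.1}) (P ⁻¹' {q.val.2}) : ℝ) /
    (((P ⁻¹' {q.val.1}).ncard : ℝ) * ((P ⁻¹' {q.val.2}).ncard : ℝ))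

/-- `M_k(G)`: the set of density matrices of balanced `k`-partitions of `V(G)`. -/
def Mset (k : ℕ) {n : ℕ} (G : SimpleGraph (Fin n)) : Set (SymIdx k → ℝ) :=
  { M | ∃ P : Fin n → Fin k, IsBalanced P ∧ M = partMatrix G P }

/-- The expectation of `f S`, where the random subset `S` of `E` contains each `e ∈ E`
independently with probability `p e`. -/
def bernSum {α : Type*} [DecidableEq α] (p : α → ℝ) (E : Finset α) (f : Finset α → ℝ) : ℝ :=
  ∑ S ∈ E.powerset, (∏ e ∈ E, if e ∈ S then p e else 1 - p e) * f S

lemma bernSum_insert {α : Type*} [DecidableEq α] (p : α → ℝ) {E : Finset α} {a : α} (ha : a ∉ E)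
    (f : Finset α → ℝ) :
    bernSum p (insert a E) f =
      p a * bernSum p E (fun S => f (insert a S)) + (1 - p a) * bernSum p E f := by
  have hne : ∀ e ∈ E, e ≠ a := fun e he h => ha (h ▸ he)
  unfold bernSum
  rw [Finset.sum_powerset_insert ha, add_comm, Finset.mul_sum, Finset.mul_sum]
  congr 1 <;> refine Finset.sum_congr rfl fun S hS => ?_
  · rw [Finset.prod_insert ha, if_pos (Finset.mem_insert_self a S), mul_assoc]
    congr 2
    exact Finset.prod_congr rfl fun e he => by simp [Finset.mem_insert, hne e he]
  · have haS : a ∉ S := fun h => ha (Finset.mem_powerset.1 hS h)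
    rw [Finset.prod_insert ha, if_neg haS, mul_assoc]

lemma bernSum_sub {α : Type*} [DecidableEq α] (p : α → ℝ) (E : Finset α) (f g : Finset α → ℝ) :
    bernSum p E (fun S => f S - g S) = bernSum p E f - bernSum p E g := by
  simp [bernSum, mul_sub, Finset.sum_sub_distrib]

lemma bernSum_const {α : Type*} [DecidableEq α] (p : α → ℝ) (E : Finset α) (c : ℝ) :
    bernSum p E (fun _ => c) = c := by
  induction E using Finset.induction_on with
  | empty => simp [bernSum]
  | insert a E ha ih => rw [bernSum_insert p ha, ih]; ring

lemma bernSum_mono {α : Type*} [DecidableEq α] {p : α → ℝ} (hp0 : ∀ e, 0 ≤ p e)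
    (hp1 : ∀ e, p e ≤ 1) (E : Finset α) {f g : Finset α → ℝ} (h : ∀ S, f S ≤ g S) :
    bernSum p E f ≤ bernSum p E g := by
  refine Finset.sum_le_sum fun S _ => mul_le_mul_of_nonneg_left (h S) ?_
  refine Finset.prod_nonneg fun e _ => ?_
  split_ifs
  · exact hp0 e
  · linarith [hp1 e]

lemma abs_bernSum_le {α : Type*} [DecidableEq α] {p : α → ℝ} (hp0 : ∀ e, 0 ≤ p e)
    (hp1 : ∀ e, p e ≤ 1) (E : Finset α) {f : Finset α → ℝ} {c : ℝ} (h : ∀ S, |f S| ≤ c) :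
    |bernSum p E f| ≤ c := by
  rw [abs_le]
  constructor
  · rw [← bernSum_const p E (-c)]
    exact bernSum_mono hp0 hp1 E fun S => (abs_le.1 (h S)).1
  · conv_rhs => rw [← bernSum_const p E c]
    exact bernSum_mono hp0 hp1 E fun S => (abs_le.1 (h S)).2

lemma abs_bernSum_sub_bernSum_le {α : Type*} [DecidableEq α] {p q : α → ℝ} (hp0 : ∀ e, 0 ≤ p e)
    (hp1 : ∀ e, p e ≤ 1) (hq0 : ∀ e, 0 ≤ q e) (hq1 : ∀ e, q e ≤ 1) {L : ℝ}
    (E : Finset α) {f : Finset α → ℝ} (hf : ∀ a S, |f (insert a S) - f S| ≤ L) :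
    |bernSum p E f - bernSum q E f| ≤ L * ∑ e ∈ E, |p e - q e| := by
  induction E using Finset.induction_on generalizing f with
  | empty => simp [bernSum]
  | insert a E ha ih =>
    rw [bernSum_insert p ha, bernSum_insert q ha, Finset.sum_insert ha]
    have h0 := ih hf
    have h1 := ih (f := fun S => f (insert a S)) fun b S => by
      rw [Finset.insert_comm]; exact hf b _
    have h2 : |bernSum q E (fun S => f (insert a S)) - bernSum q E f| ≤ L := by
      rw [← bernSum_sub]
      exact abs_bernSum_le hq0 hq1 E fun S => hf a S
    set A := bernSum p E (fun S => f (insert a S))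
    set A' := bernSum q E (fun S => f (insert a S))
    set D := bernSum p E f
    set D' := bernSum q E f
    have hp' : 0 ≤ 1 - p a := by linarith [hp1 a]
    calc |p a * A + (1 - p a) * D - (q a * A' + (1 - q a) * D')|
        = |p a * (A - A') + (1 - p a) * (D - D') + (p a - q a) * (A' - D')| := by
          congr 1; ring
      _ ≤ |p a * (A - A')| + |(1 - p a) * (D - D')| + |(p a - q a) * (A' - D')| :=
          abs_add_three _ _ _
      _ = p a * |A - A'| + (1 - p a) * |D - D'| + |p a - q a| * |A' - D'| := by
          rw [abs_mul, abs_mul, abs_mul, abs_of_nonneg (hp0 a), abs_of_nonneg hp']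
      _ ≤ p a * (L * ∑ e ∈ E, |p e - q e|) + (1 - p a) * (L * ∑ e ∈ E, |p e - q e|)
            + |p a - q a| * L := by
          have := hp0 a
          gcongr
      _ = L * (|p a - q a| + ∑ e ∈ E, |p e - q e|) := by ring

/-- Efron–Stein type variance bound for a function of independent Bernoulli variables. -/
lemma bernSum_sq_sub_sq_le {α : Type*} [DecidableEq α] {p : α → ℝ} (hp0 : ∀ e, 0 ≤ p e)
    (hp1 : ∀ e, p e ≤ 1) {L : ℝ} (E : Finset α) {f : Finset α → ℝ}
    (hf : ∀ a S, |f (insert a S) - f S| ≤ L) :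
    bernSum p E (fun S => f S ^ 2) - bernSum p E f ^ 2 ≤ L ^ 2 * ∑ e ∈ E, p e := by
  induction E using Finset.induction_on generalizing f with
  | empty => simp [bernSum]
  | insert a E ha ih =>
    rw [bernSum_insert p ha, bernSum_insert p ha, Finset.sum_insert ha]
    have h0 := ih hf
    have h1 := ih (f := fun S => f (insert a S)) fun b S => by
      rw [Finset.insert_comm]; exact hf b _
    have h2 : |bernSum p E (fun S => f (insert a S)) - bernSum p E f| ≤ L := by
      rw [← bernSum_sub]
      exact abs_bernSum_le hp0 hp1 E fun S => hf a S
    set A := bernSum p E (fun S => f (insert a S))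
    set D := bernSum p E f
    have h3 : (A - D) ^ 2 ≤ L ^ 2 := sq_le_sq' (abs_le.1 h2).1 (abs_le.1 h2).2
    have hp' : 0 ≤ 1 - p a := by linarith [hp1 a]
    have e1 := mul_le_mul_of_nonneg_left h1 (hp0 a)
    have e0 := mul_le_mul_of_nonneg_left h0 hp'
    have e2 : p a * (1 - p a) * (A - D) ^ 2 ≤ p a * L ^ 2 := by
      calc p a * (1 - p a) * (A - D) ^ 2 ≤ p a * 1 * L ^ 2 := by
            have := hp0 a
            gcongr
            linarith
        _ = p a * L ^ 2 := by ring
    nlinarith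

lemma integral_sq_sub_sq_le_of_abs_sub_le {α : Type*} [MeasurableSpace α] (μ : Measure α)
    [IsProbabilityMeasure μ] {h : α → ℝ} (hm : Measurable h) {M c : ℝ}
    (hM : ∀ t, |h t| ≤ M) (hc : ∀ s t, |h s - h t| ≤ c) :
    ∫ t, h t ^ 2 ∂μ - (∫ t, h t ∂μ) ^ 2 ≤ c ^ 2 := by
  have hi : Integrable h μ := .of_bound hm.aestronglyMeasurable M (ae_of_all _ hM)
  have hi2 : Integrable (fun t => h t ^ 2) μ := by
    refine .of_bound (hm.pow_const 2).aestronglyMeasurable (M ^ 2) (ae_of_all _ fun t => ?_)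
    rw [Real.norm_eq_abs, abs_pow]
    exact pow_le_pow_left₀ (abs_nonneg _) (hM t) 2
  set m := ∫ t, h t ∂μ with hmdef
  have hdev : ∀ s, |h s - m| ≤ c := fun s => by
    have : h s - m = ∫ t, (h s - h t) ∂μ := by
      rw [integral_sub (integrable_const _) hi]; simp [m]
    rw [this]
    have hb : ∀ t, ‖h s - h t‖ ≤ c := hc s
    simpa using norm_integral_le_of_norm_le_const (μ := μ) (ae_of_all _ hb)
  have hi3 : Integrable (fun t => h t ^ 2 - 2 * m * h t) μ := hi2.sub (hi.const_mul _)
  have hsq : ∫ t, (h t ^ 2 - 2 * m * h t + m ^ 2) ∂μ ≤ ∫ _, c ^ 2 ∂μ := by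
    refine integral_mono (hi3.add (integrable_const _)) (integrable_const _) fun t => ?_
    have := sq_le_sq' (abs_le.1 (hdev t)).1 (abs_le.1 (hdev t)).2
    simp only
    linarith
  rw [integral_add hi3 (integrable_const _),
    integral_sub hi2 (hi.const_mul _), integral_const_mul, ← hmdef] at hsq
  simp only [integral_const, probReal_univ, smul_eq_mul, one_mul] at hsq
  linarith

/-- Efron–Stein type variance bound for a function with bounded differences of
i.i.d. variables. -/
lemma integral_pi_sq_sub_sq_le {α : Type*} [MeasurableSpace α] (μ : Measure α)
    [IsProbabilityMeasure μ] {M c : ℝ} (n : ℕ) {g : (Fin n → α) → ℝ} (hm : Measurable g)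
    (hM : ∀ x, |g x| ≤ M) (hc : ∀ x i t, |g (Function.update x i t) - g x| ≤ c) :
    ∫ x, g x ^ 2 ∂(Measure.pi fun _ => μ) - (∫ x, g x ∂(Measure.pi fun _ => μ)) ^ 2
      ≤ n * c ^ 2 := by
  induction n with
  | zero =>
    have : g = fun _ => g default := funext fun x => congrArg g (Subsingleton.elim _ _)
    rw [this]
    simp
  | succ n ih =>
    have key : ∀ φ : (Fin (n + 1) → α) → ℝ, ∫ x, φ x ∂(Measure.pi fun _ => μ) =
        ∫ z, φ (Fin.cons z.1 z.2) ∂(μ.prod (Measure.pi fun _ : Fin n => μ)) := fun φ => by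
      rw [← (measurePreserving_piFinSuccAbove (fun _ : Fin (n + 1) => μ) 0).symm.integral_comp']
      refine integral_congr_ae (ae_of_all _ fun z => ?_)
      simp [MeasurableEquiv.piFinSuccAbove_symm_apply, Fin.insertNthEquiv]
    have hcons : Measurable fun z : α × (Fin n → α) => (Fin.cons z.1 z.2 : Fin (n + 1) → α) := by
      refine measurable_pi_iff.2 fun i => ?_
      refine Fin.cases ?_ (fun j => ?_) i
      · simpa using measurable_fst
      · simpa using! (measurable_pi_apply j).comp measurable_snd
    have hgm := hm.comp hcons
    have hg2 : ∀ x, ‖g x ^ 2‖ ≤ M ^ 2 := fun x => by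
      rw [Real.norm_eq_abs, abs_pow]
      exact pow_le_pow_left₀ (abs_nonneg _) (hM x) 2
    have hint : Integrable (fun z : α × (Fin n → α) => g (Fin.cons z.1 z.2))
        (μ.prod (Measure.pi fun _ : Fin n => μ)) :=
      .of_bound hgm.aestronglyMeasurable M (ae_of_all _ fun _ => hM _)
    have hint2 : Integrable (fun z : α × (Fin n → α) => g (Fin.cons z.1 z.2) ^ 2)
        (μ.prod (Measure.pi fun _ : Fin n => μ)) :=
      .of_bound (hgm.pow_const 2).aestronglyMeasurable (M ^ 2) (ae_of_all _ fun _ => hg2 _)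
    rw [key, key, integral_prod _ hint, integral_prod _ hint2]
    simp only
    set h : α → ℝ := fun t => ∫ z, g (Fin.cons t z) ∂(Measure.pi fun _ : Fin n => μ)
    have hhm : Measurable h :=
      (hgm.stronglyMeasurable.integral_prod_right' (ν := Measure.pi fun _ : Fin n => μ)).measurable
    have hslice : ∀ t, Measurable fun z : Fin n → α => g (Fin.cons t z) := fun t =>
      hgm.comp measurable_prodMk_left
    have hsliceI : ∀ t, Integrable (fun z : Fin n → α => g (Fin.cons t z))
        (Measure.pi fun _ : Fin n => μ) := fun t =>
      .of_bound (hslice t).aestronglyMeasurable M (ae_of_all _ fun _ => hM _)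
    have hhM : ∀ t, |h t| ≤ M := fun t => by
      have hb : ∀ z : Fin n → α, ‖g (Fin.cons t z)‖ ≤ M := fun z => hM _
      simpa using norm_integral_le_of_norm_le_const (μ := Measure.pi fun _ : Fin n => μ)
        (ae_of_all _ hb)
    have hhc : ∀ s t, |h s - h t| ≤ c := fun s t => by
      have e : h s - h t = ∫ z, (g (Fin.cons s z) - g (Fin.cons t z))
          ∂(Measure.pi fun _ : Fin n => μ) := (integral_sub (hsliceI s) (hsliceI t)).symm
      rw [e]
      have hb : ∀ z : Fin n → α, ‖g (Fin.cons s z) - g (Fin.cons t z)‖ ≤ c := fun z => by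
        have := hc (Fin.cons t z) 0 s
        rwa [Fin.update_cons_zero] at this
      simpa using norm_integral_le_of_norm_le_const (μ := Measure.pi fun _ : Fin n => μ)
        (ae_of_all _ hb)
    have h1 := integral_sq_sub_sq_le_of_abs_sub_le μ hhm hhM hhc
    have hh2 : Integrable (fun t => h t ^ 2) μ := by
      refine .of_bound (hhm.pow_const 2).aestronglyMeasurable (M ^ 2) (ae_of_all _ fun t => ?_)
      rw [Real.norm_eq_abs, abs_pow]
      exact pow_le_pow_left₀ (abs_nonneg _) (hhM t) 2
    have h2 : ∫ t, ∫ z, g (Fin.cons t z) ^ 2 ∂(Measure.pi fun _ : Fin n => μ) ∂μ ≤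
        ∫ t, (h t ^ 2 + n * c ^ 2) ∂μ := by
      refine integral_mono hint2.integral_prod_left (hh2.add (integrable_const _)) fun t => ?_
      have := ih (hslice t) (fun z => hM _) fun z i s => by
        rw [Fin.cons_update]; exact hc _ _ _
      simp only
      linarith
    rw [integral_add hh2 (integrable_const _)] at h2
    simp only [integral_const, probReal_univ, smul_eq_mul, one_mul] at h2
    push_cast
    linarith

lemma sum_biUnion_le_of_nonneg {Ω ι : Type*} {w : Ω → ℝ} (hw : ∀ ω, 0 ≤ w ω)
    (t : Finset ι) (A : ι → Finset Ω) :
    ∑ ω ∈ t.biUnion A, w ω ≤ ∑ i ∈ t, ∑ ω ∈ A i, w ω := by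
  induction t using Finset.induction_on with
  | empty => simp
  | insert i t hi ih =>
    rw [Finset.biUnion_insert, Finset.sum_insert hi]
    have h1 := Finset.sum_union_inter (f := w) (s₁ := A i) (s₂ := t.biUnion A)
    have h2 := Finset.sum_nonneg (s := A i ∩ t.biUnion A) fun ω _ => hw ω
    linarith

lemma sum_filter_lt_le_div {Ω : Type*} [Fintype Ω] {w φ : Ω → ℝ} (hw : ∀ ω, 0 ≤ w ω)
    (hφ : ∀ ω, 0 ≤ φ ω) {a : ℝ} (ha : 0 < a) :
    ∑ ω ∈ Finset.univ.filter (fun ω => a < φ ω), w ω ≤ (∑ ω, w ω * φ ω) / a := by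
  rw [le_div_iff₀ ha, Finset.sum_mul]
  calc ∑ ω ∈ Finset.univ.filter (fun ω => a < φ ω), w ω * a
      ≤ ∑ ω ∈ Finset.univ.filter (fun ω => a < φ ω), w ω * φ ω :=
        Finset.sum_le_sum fun ω hω =>
          mul_le_mul_of_nonneg_left (Finset.mem_filter.1 hω).2.le (hw ω)
    _ ≤ ∑ ω, w ω * φ ω :=
        Finset.sum_le_sum_of_subset_of_nonneg (Finset.filter_subset _ _)
          fun ω _ _ => mul_nonneg (hw ω) (hφ ω)

/-- If outside an event of weight at most `η < 1` all values of `X` are within `r` of each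
other, then `X` is close on average to one of its values. -/
lemma exists_sum_mul_min_dist_le {Ω Z : Type*} [Fintype Ω] [PseudoMetricSpace Z] {w : Ω → ℝ}
    (hw : ∀ ω, 0 ≤ w ω) (hw1 : ∑ ω, w ω = 1) (X : Ω → Z) {s : Finset Ω} {η r : ℝ}
    (hη : η < 1) (hr : 0 ≤ r) (hs : ∑ ω ∈ s, w ω ≤ η)
    (h : ∀ ω ∉ s, ∀ ω' ∉ s, dist (X ω) (X ω') ≤ r) :
    ∃ ω₀, ∑ ω, w ω * min (dist (X ω) (X ω₀)) 1 ≤ r + η := by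
  obtain ⟨ω₀, h₀⟩ : ∃ ω₀, ω₀ ∉ s := by
    by_contra! hall
    rw [Finset.eq_univ_of_forall hall, hw1] at hs
    linarith
  refine ⟨ω₀, ?_⟩
  calc ∑ ω, w ω * min (dist (X ω) (X ω₀)) 1
      ≤ ∑ ω, (w ω * r + if ω ∈ s then w ω else 0) := by
        refine Finset.sum_le_sum fun ω _ => ?_
        split_ifs with hω
        · have := mul_le_mul_of_nonneg_left (min_le_right (dist (X ω) (X ω₀)) 1) (hw ω)
          have := mul_nonneg (hw ω) hr
          linarith
        · rw [add_zero]
          exact mul_le_mul_of_nonneg_left ((min_le_left _ _).trans (h ω hω ω₀ h₀)) (hw ω)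
    _ = r + ∑ ω ∈ s, w ω := by
        rw [Finset.sum_add_distrib, ← Finset.sum_mul, hw1, one_mul, Finset.sum_ite_mem,
          Finset.univ_inter]
    _ ≤ r + η := by linarith

/-- A tight sequence of random points `X n` all of whose distances to fixed points
concentrate is itself concentrated around deterministic points. -/
lemma exists_tendsto_sum_dist {Ω : ℕ → Type*} [∀ n, Fintype (Ω n)] [∀ n, Nonempty (Ω n)]
    {Z : Type*} [PseudoMetricSpace Z] (z₀ : Z)
    (hZ : ∀ K, TotallyBounded (Metric.closedBall z₀ K))
    {w : ∀ n, Ω n → ℝ} (hw : ∀ n ω, 0 ≤ w n ω) (hw1 : ∀ n, ∑ ω, w n ω = 1)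
    (X : ∀ n, Ω n → Z)
    (hT : ∃ C, ∀ᶠ n in atTop, ∑ ω, w n ω * dist (X n ω) z₀ ≤ C)
    (hc : ∀ z, ∃ m : ℕ → ℝ,
      Tendsto (fun n => ∑ ω, w n ω * (dist (X n ω) z - m n) ^ 2) atTop (nhds 0)) :
    ∃ Y : ℕ → Z, ∀ ε : ℝ, 0 < ε → Tendsto
      (fun n => ∑ ω ∈ Finset.univ.filter (fun ω => ε < dist (X n ω) (Y n)), w n ω)
      atTop (nhds 0) := by
  choose m hm using hc
  obtain ⟨C, hC⟩ := hT
  choose ω₀ hω₀ using fun n => Finite.exists_min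
    (fun ω' : Ω n => ∑ ω, w n ω * min (dist (X n ω) (X n ω')) 1)
  set Φ : ℕ → ℝ := fun n => ∑ ω, w n ω * min (dist (X n ω) (X n (ω₀ n))) 1 with hΦ
  have hmin0 : ∀ n (ω ω' : Ω n), 0 ≤ min (dist (X n ω) (X n ω')) 1 := fun n ω ω' =>
    le_min dist_nonneg zero_le_one
  have hΦ0 : ∀ n, 0 ≤ Φ n := fun n =>
    Finset.sum_nonneg fun ω _ => mul_nonneg (hw n ω) (hmin0 n _ _)
  have hsmall : ∀ δ : ℝ, 0 < δ → δ < 1 / 2 → ∀ᶠ n in atTop, Φ n ≤ 6 * δ := by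
    intro δ hδ hδ'
    set K := (|C| + 1) / δ
    have hK : 0 < K := by positivity
    obtain ⟨t, ht, hcov⟩ := Metric.totallyBounded_iff.1 (hZ K) δ hδ
    lift t to Finset Z using ht
    have hsum : Tendsto (fun n => ∑ z ∈ t,
        (∑ ω, w n ω * (dist (X n ω) z - m z n) ^ 2) / δ ^ 2) atTop (nhds 0) := by
      simpa using tendsto_finsetSum t fun z _ => (hm z).div_const (δ ^ 2)
    filter_upwards [hC, hsum.eventually (gt_mem_nhds hδ)] with n hn hn'
    set s : Finset (Ω n) := Finset.univ.filter (fun ω => K < dist (X n ω) z₀) ∪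
      t.biUnion fun z => Finset.univ.filter fun ω => δ ^ 2 < (dist (X n ω) z - m z n) ^ 2
    have hs : ∑ ω ∈ s, w n ω ≤ 2 * δ := by
      have h1 : ∑ ω ∈ Finset.univ.filter (fun ω => K < dist (X n ω) z₀), w n ω ≤ δ := by
        refine (sum_filter_lt_le_div (hw n) (fun _ => dist_nonneg) hK).trans ?_
        rw [div_le_iff₀ hK, mul_div_cancel₀ _ hδ.ne']
        linarith [le_abs_self C]
      have h2 : ∑ ω ∈ t.biUnion fun z => Finset.univ.filter fun ω =>
          δ ^ 2 < (dist (X n ω) z - m z n) ^ 2, w n ω ≤ δ := by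
        refine le_trans ?_ hn'.le
        refine (sum_biUnion_le_of_nonneg (hw n) t _).trans ?_
        exact Finset.sum_le_sum fun z _ =>
          sum_filter_lt_le_div (hw n) (fun _ => sq_nonneg _) (by positivity)
      have h3 := Finset.sum_union_inter (f := w n)
        (s₁ := Finset.univ.filter (fun ω => K < dist (X n ω) z₀))
        (s₂ := t.biUnion fun z => Finset.univ.filter fun ω =>
          δ ^ 2 < (dist (X n ω) z - m z n) ^ 2)
      have h4 := Finset.sum_nonneg (s := Finset.univ.filter (fun ω => K < dist (X n ω) z₀) ∩
        t.biUnion fun z => Finset.univ.filter fun ω =>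
          δ ^ 2 < (dist (X n ω) z - m z n) ^ 2) (fun ω _ => hw n ω)
      linarith
    have hdist : ∀ ω ∉ s, ∀ ω' ∉ s, dist (X n ω) (X n ω') ≤ 4 * δ := by
      intro ω hω ω' hω'
      simp only [s, Finset.mem_union, Finset.mem_filter, Finset.mem_univ, true_and,
        Finset.mem_biUnion, not_or, not_exists, not_and, not_lt] at hω hω'
      obtain ⟨z, hz, hzω⟩ := mem_iUnion₂.1 (hcov (Metric.mem_closedBall.2 hω.1))
      have hzω := Metric.mem_ball.1 hzω
      have h1 := abs_le.1 (abs_le_of_sq_le_sq (hω.2 z hz) hδ.le)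
      have h2 := abs_le.1 (abs_le_of_sq_le_sq (hω'.2 z hz) hδ.le)
      have h3 := dist_triangle_right (X n ω) (X n ω') z
      linarith
    obtain ⟨ω₁, h₁⟩ := exists_sum_mul_min_dist_le (hw n) (hw1 n) (X n) (by linarith)
      (by positivity) hs hdist
    have := hω₀ n ω₁
    simp only [hΦ]
    linarith
  have hΦt : Tendsto Φ atTop (nhds 0) := by
    rw [Metric.tendsto_nhds]
    intro ε hε
    have hδ : 0 < min (ε / 12) (1 / 4) := by positivity
    filter_upwards [hsmall _ hδ (by linarith [min_le_right (ε / 12) (1 / 4 : ℝ)])] with n hn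
    rw [Real.dist_eq, sub_zero, abs_of_nonneg (hΦ0 n)]
    linarith [min_le_left (ε / 12) (1 / 4 : ℝ)]
  refine ⟨fun n => X n (ω₀ n), fun ε hε => ?_⟩
  have hε' : 0 < min ε 1 / 2 := by positivity
  refine squeeze_zero (fun n => Finset.sum_nonneg fun ω _ => hw n ω) (fun n => ?_)
    (by simpa using hΦt.div_const (min ε 1 / 2))
  refine le_trans ?_ (sum_filter_lt_le_div (hw n) (fun ω => hmin0 n ω (ω₀ n)) hε')
  refine Finset.sum_le_sum_of_subset_of_nonneg (fun ω hω => ?_) fun ω _ _ => hw n ω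
  simp only [Finset.mem_filter, Finset.mem_univ, true_and] at hω ⊢
  rcases min_cases ε 1 with h | h <;> rcases min_cases (dist (X n ω) (X n (ω₀ n))) 1 with h' | h'
    <;> linarith

/-- The pairs `(i, j)` of vertices with `i < j`. -/
def ltPairs (n : ℕ) : Finset (Fin n × Fin n) :=
  Finset.univ.filter fun q : Fin n × Fin n => q.1 < q.2

/-- The graph whose edges are the non-diagonal pairs in `S`. -/
def graphOf {n : ℕ} (S : Finset (Fin n × Fin n)) : SimpleGraph (Fin n) :=
  SimpleGraph.fromRel fun a b => (a, b) ∈ S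

/-- The probability that the pair `q` is an edge of `G_{1/n}(n,κ)` given the types `x`. -/
def edgeProb (κ : ℝ → ℝ → ℝ) (n : ℕ) (x : Fin n → ℝ) (q : Fin n × Fin n) : ℝ :=
  min (κ (x q.1) (x q.2) / n) 1

/-- The probability that `G_{1/n}(n,κ)` equals `G`. -/
def graphProb (κ : ℝ → ℝ → ℝ) (n : ℕ) (G : SimpleGraph (Fin n)) : ℝ :=
  ∫ x in typeCube n, condProb κ n x G

lemma graphOf_adj {n : ℕ} (S : Finset (Fin n × Fin n)) (a b : Fin n) :
    (graphOf S).Adj a b ↔ a ≠ b ∧ ((a, b) ∈ S ∨ (b, a) ∈ S) := by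
  simp [graphOf, SimpleGraph.fromRel_adj]

lemma sum_condProb_mul (κ : ℝ → ℝ → ℝ) (n : ℕ) (x : Fin n → ℝ)
    (f : SimpleGraph (Fin n) → ℝ) :
    ∑ G, condProb κ n x G * f G =
      bernSum (edgeProb κ n x) (ltPairs n) fun S => f (graphOf S) := by
  have hinv : ∀ G : SimpleGraph (Fin n),
      graphOf ((ltPairs n).filter fun q => G.Adj q.1 q.2) = G := fun G => by
    ext a b
    simp only [graphOf_adj, ltPairs, Finset.mem_filter, Finset.mem_univ, true_and]
    constructor
    · rintro ⟨-, h | h⟩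
      · exact h.2
      · exact h.2.symm
    · intro h
      refine ⟨h.ne, ?_⟩
      rcases lt_or_gt_of_ne h.ne with hlt | hlt
      · exact Or.inl ⟨hlt, h⟩
      · exact Or.inr ⟨hlt, h.symm⟩
  refine Finset.sum_bij' (fun G _ => (ltPairs n).filter fun q => G.Adj q.1 q.2)
    (fun S _ => graphOf S) (fun G _ => Finset.mem_powerset.2 (Finset.filter_subset _ _))
    (fun _ _ => Finset.mem_univ _) (fun G _ => hinv G) (fun S hS => ?_) (fun G _ => ?_)
  · ext ⟨a, b⟩
    have hS := Finset.mem_powerset.1 hS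
    have hlt : ∀ {a b}, (a, b) ∈ S → a < b := fun h => by simpa [ltPairs] using hS h
    simp only [Finset.mem_filter, graphOf_adj]
    constructor
    · rintro ⟨h1, -, h | h⟩
      · exact h
      · have h1 : a < b := by simpa [ltPairs] using h1
        exact absurd (hlt h) h1.asymm
    · intro h
      exact ⟨hS h, (hlt h).ne, Or.inl h⟩
  · simp only [hinv]
    congr 1
    refine Finset.prod_congr rfl fun q hq => ?_
    have hq' : q ∈ ltPairs n := hq
    simp only [Finset.mem_filter, hq', true_and, edgeProb]

lemma edgeProb_nonneg {κ : ℝ → ℝ → ℝ} (h0 : ∀ x y, 0 ≤ κ x y) (n : ℕ) (x : Fin n → ℝ)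
    (q : Fin n × Fin n) : 0 ≤ edgeProb κ n x q :=
  le_min (div_nonneg (h0 _ _) n.cast_nonneg) zero_le_one

lemma edgeProb_le_one (κ : ℝ → ℝ → ℝ) (n : ℕ) (x : Fin n → ℝ) (q : Fin n × Fin n) :
    edgeProb κ n x q ≤ 1 := min_le_right _ _

lemma edgeProb_le {κ : ℝ → ℝ → ℝ} {B : ℝ} (hB : ∀ x y, κ x y ≤ B) (n : ℕ)
    (x : Fin n → ℝ) (q : Fin n × Fin n) : edgeProb κ n x q ≤ B / n :=
  (min_le_left _ _).trans (div_le_div_of_nonneg_right (hB _ _) n.cast_nonneg)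

lemma sum_edgeProb_le {κ : ℝ → ℝ → ℝ} {B : ℝ} (h0 : ∀ x y, 0 ≤ κ x y)
    (hB : ∀ x y, κ x y ≤ B) {n : ℕ} (hn : 0 < n) (x : Fin n → ℝ) :
    ∑ q ∈ ltPairs n, edgeProb κ n x q ≤ n * B := by
  calc ∑ q ∈ ltPairs n, edgeProb κ n x q
      ≤ ∑ q : Fin n × Fin n, edgeProb κ n x q :=
        Finset.sum_le_sum_of_subset_of_nonneg (Finset.subset_univ _)
          fun q _ _ => edgeProb_nonneg h0 n x q
    _ ≤ ∑ _q : Fin n × Fin n, B / n := Finset.sum_le_sum fun q _ => edgeProb_le hB n x q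
    _ = n * B := by
        have : (n : ℝ) ≠ 0 := by positivity
        simp
        field_simp

lemma sum_abs_edgeProb_update_sub_le {κ : ℝ → ℝ → ℝ} {B : ℝ} (h0 : ∀ x y, 0 ≤ κ x y)
    (hB : ∀ x y, κ x y ≤ B) {n : ℕ} (hn : 0 < n) (x : Fin n → ℝ) (i : Fin n) (t : ℝ) :
    ∑ q ∈ ltPairs n, |edgeProb κ n (Function.update x i t) q - edgeProb κ n x q| ≤ 2 * B := by
  have hB0 : 0 ≤ B / n := div_nonneg ((h0 0 0).trans (hB 0 0)) n.cast_nonneg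
  calc ∑ q ∈ ltPairs n, |edgeProb κ n (Function.update x i t) q - edgeProb κ n x q|
      ≤ ∑ q : Fin n × Fin n, |edgeProb κ n (Function.update x i t) q - edgeProb κ n x q| :=
        Finset.sum_le_sum_of_subset_of_nonneg (Finset.subset_univ _) fun q _ _ => abs_nonneg _
    _ ≤ ∑ q : Fin n × Fin n, ((if q.1 = i then B / n else 0) + if q.2 = i then B / n else 0) := by
        refine Finset.sum_le_sum fun q _ => ?_
        by_cases h : q.1 = i ∨ q.2 = i
        · refine le_trans (b := B / n) ?_ ?_
          · rw [abs_le]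
            have := edgeProb_le hB n (Function.update x i t) q
            have := edgeProb_le hB n x q
            have := edgeProb_nonneg h0 n (Function.update x i t) q
            have := edgeProb_nonneg h0 n x q
            constructor <;> linarith
          · rcases h with h | h
            · rw [if_pos h]; split_ifs <;> linarith
            · rw [if_pos h]; split_ifs <;> linarith
        · rw [not_or] at h
          simp [edgeProb, h.1, h.2]
    _ = 2 * B := by
        have : (n : ℝ) ≠ 0 := by positivity
        have h1 : ∑ q : Fin n × Fin n, (if q.1 = i then B / n else 0) = B := by
          rw [Fintype.sum_prod_type_right]
          simp [mul_div_cancel₀ _ this]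
        have h2 : ∑ q : Fin n × Fin n, (if q.2 = i then B / n else 0) = B := by
          rw [Fintype.sum_prod_type]
          simp [mul_div_cancel₀ _ this]
        rw [Finset.sum_add_distrib, h1, h2, two_mul]

lemma measurable_condProb {κ : ℝ → ℝ → ℝ} (hm : Measurable (Function.uncurry κ)) (n : ℕ)
    (G : SimpleGraph (Fin n)) : Measurable fun x => condProb κ n x G := by
  have he : ∀ q : Fin n × Fin n,
      Measurable fun x : Fin n → ℝ => min (κ (x q.1) (x q.2) / n) 1 := fun q => by
    have : Measurable fun x : Fin n → ℝ => κ (x q.1) (x q.2) :=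
      hm.comp (f := fun x : Fin n → ℝ => (x q.1, x q.2))
        ((measurable_pi_apply q.1).prodMk (measurable_pi_apply q.2))
    exact (this.div_const _).min measurable_const
  refine Finset.measurable_prod _ fun q _ => ?_
  split_ifs
  · exact he q
  · exact measurable_const.sub (he q)

lemma condProb_nonneg {κ : ℝ → ℝ → ℝ} (h0 : ∀ x y, 0 ≤ κ x y) (n : ℕ) (x : Fin n → ℝ)
    (G : SimpleGraph (Fin n)) : 0 ≤ condProb κ n x G := by
  refine Finset.prod_nonneg fun q _ => ?_
  split_ifs
  · exact edgeProb_nonneg h0 n x q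
  · exact sub_nonneg.2 (edgeProb_le_one κ n x q)

lemma sum_condProb (κ : ℝ → ℝ → ℝ) (n : ℕ) (x : Fin n → ℝ) :
    ∑ G, condProb κ n x G = 1 := by
  simpa [bernSum_const] using sum_condProb_mul κ n x fun _ => 1

lemma volume_restrict_typeCube (n : ℕ) :
    (volume : Measure (Fin n → ℝ)).restrict (typeCube n) =
      Measure.pi fun _ => (volume : Measure ℝ).restrict (Icc 0 1) := by
  rw [volume_pi, typeCube, Measure.restrict_pi_pi]

lemma isProbabilityMeasure_restrict_Icc :
    IsProbabilityMeasure ((volume : Measure ℝ).restrict (Icc 0 1)) :=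
  ⟨by simp⟩

lemma isProbabilityMeasure_restrict_typeCube (n : ℕ) :
    IsProbabilityMeasure ((volume : Measure (Fin n → ℝ)).restrict (typeCube n)) := by
  have := isProbabilityMeasure_restrict_Icc
  rw [volume_restrict_typeCube]
  infer_instance

lemma integrable_condProb {κ : ℝ → ℝ → ℝ} (hm : Measurable (Function.uncurry κ))
    (h0 : ∀ x y, 0 ≤ κ x y) (n : ℕ) (G : SimpleGraph (Fin n)) :
    Integrable (fun x => condProb κ n x G) (volume.restrict (typeCube n)) := by
  have := isProbabilityMeasure_restrict_typeCube n
  refine .of_bound (measurable_condProb hm n G).aestronglyMeasurable 1 (ae_of_all _ fun x => ?_)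
  rw [Real.norm_eq_abs, abs_of_nonneg (condProb_nonneg h0 n x G), ← sum_condProb κ n x]
  exact Finset.single_le_sum (fun G _ => condProb_nonneg h0 n x G) (Finset.mem_univ G)

lemma graphProb_nonneg {κ : ℝ → ℝ → ℝ} (h0 : ∀ x y, 0 ≤ κ x y) (n : ℕ)
    (G : SimpleGraph (Fin n)) : 0 ≤ graphProb κ n G :=
  integral_nonneg fun x => condProb_nonneg h0 n x G

lemma gProb_eq_sum {κ : ℝ → ℝ → ℝ} (hm : Measurable (Function.uncurry κ))
    (h0 : ∀ x y, 0 ≤ κ x y) (n : ℕ) (A : Set (SimpleGraph (Fin n))) :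
    gProb κ n A = ∑ G ∈ Finset.univ.filter (fun G => G ∈ A), graphProb κ n G :=
  integral_finsetSum _ fun G _ => integrable_condProb hm h0 n G

lemma sum_graphProb_mul {κ : ℝ → ℝ → ℝ} (hm : Measurable (Function.uncurry κ))
    (h0 : ∀ x y, 0 ≤ κ x y) (n : ℕ) (f : SimpleGraph (Fin n) → ℝ) :
    ∑ G, graphProb κ n G * f G = ∫ x in typeCube n,
      bernSum (edgeProb κ n x) (ltPairs n) fun S => f (graphOf S) := by
  simp_rw [← sum_condProb_mul]
  rw [integral_finsetSum _ fun G _ => (integrable_condProb hm h0 n G).mul_const _]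
  exact Finset.sum_congr rfl fun G _ => (integral_mul_const _ _).symm

lemma sum_graphProb {κ : ℝ → ℝ → ℝ} (hm : Measurable (Function.uncurry κ))
    (h0 : ∀ x y, 0 ≤ κ x y) (n : ℕ) : ∑ G, graphProb κ n G = 1 := by
  have := isProbabilityMeasure_restrict_typeCube n
  simpa [bernSum_const] using sum_graphProb_mul hm h0 n fun _ => 1

lemma measurable_bernSum_edgeProb {κ : ℝ → ℝ → ℝ} (hm : Measurable (Function.uncurry κ))
    (n : ℕ) (f : SimpleGraph (Fin n) → ℝ) :
    Measurable fun x => bernSum (edgeProb κ n x) (ltPairs n) fun S => f (graphOf S) := by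
  simp_rw [← sum_condProb_mul]
  exact Finset.measurable_fun_sum _ fun G _ => (measurable_condProb hm n G).mul_const _

lemma exists_abs_bernSum_edgeProb_le {κ : ℝ → ℝ → ℝ} (h0 : ∀ x y, 0 ≤ κ x y) (n : ℕ)
    (f : SimpleGraph (Fin n) → ℝ) :
    ∃ M, ∀ x, |bernSum (edgeProb κ n x) (ltPairs n) fun S => f (graphOf S)| ≤ M := by
  refine ⟨∑ G, |f G|, fun x => ?_⟩
  exact abs_bernSum_le (edgeProb_nonneg h0 n x) (edgeProb_le_one κ n x) _ fun S =>
    Finset.single_le_sum (f := fun G => |f G|) (fun G _ => abs_nonneg _) (Finset.mem_univ _)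

lemma integrable_bernSum_edgeProb {κ : ℝ → ℝ → ℝ} (hm : Measurable (Function.uncurry κ))
    (h0 : ∀ x y, 0 ≤ κ x y) (n : ℕ) (f : SimpleGraph (Fin n) → ℝ) :
    Integrable (fun x => bernSum (edgeProb κ n x) (ltPairs n) fun S => f (graphOf S))
      (volume.restrict (typeCube n)) := by
  have := isProbabilityMeasure_restrict_typeCube n
  obtain ⟨M, hM⟩ := exists_abs_bernSum_edgeProb_le h0 n f
  exact .of_bound (measurable_bernSum_edgeProb hm n f).aestronglyMeasurable M (ae_of_all _ hM)

/-- Mean bound for a function of `G_{1/n}(n,κ)` that changes by at most `L` when an edge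
is added. -/
lemma sum_graphProb_mul_le {κ : ℝ → ℝ → ℝ} {B : ℝ} (hm : Measurable (Function.uncurry κ))
    (h0 : ∀ x y, 0 ≤ κ x y) (hB : ∀ x y, κ x y ≤ B) {n : ℕ} (hn : 0 < n) {L : ℝ} (hL : 0 ≤ L)
    {f : SimpleGraph (Fin n) → ℝ}
    (hf : ∀ a S, |f (graphOf (insert a S)) - f (graphOf S)| ≤ L) :
    ∑ G, graphProb κ n G * f G ≤ f ⊥ + L * (n * B) := by
  have := isProbabilityMeasure_restrict_typeCube n
  rw [sum_graphProb_mul hm h0]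
  have hbot : (graphOf ∅ : SimpleGraph (Fin n)) = ⊥ := by
    ext a b; simp [graphOf_adj]
  have hzero : bernSum (fun _ => 0) (ltPairs n) (fun S => f (graphOf S)) = f ⊥ := by
    unfold bernSum
    rw [Finset.sum_eq_single ∅]
    · simp [hbot]
    · intro S hS hne
      obtain ⟨e, he⟩ := Finset.nonempty_iff_ne_empty.2 hne
      rw [Finset.prod_eq_zero (Finset.mem_powerset.1 hS he) (by simp [he]), zero_mul]
    · simp
  calc ∫ x in typeCube n, bernSum (edgeProb κ n x) (ltPairs n) (fun S => f (graphOf S))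
      ≤ ∫ _ in typeCube n, (f ⊥ + L * (n * B)) := by
        refine integral_mono (integrable_bernSum_edgeProb hm h0 n f) (integrable_const _)
          fun x => ?_
        have h1 := (abs_le.1 (abs_bernSum_sub_bernSum_le (edgeProb_nonneg h0 n x)
          (edgeProb_le_one κ n x) (fun _ => le_rfl) (fun _ => zero_le_one) (ltPairs n)
          (f := fun S => f (graphOf S)) hf)).2
        rw [hzero] at h1
        have h2 := mul_le_mul_of_nonneg_left (sum_edgeProb_le h0 hB hn x) hL
        have h3 : ∑ q ∈ ltPairs n, |edgeProb κ n x q - 0| =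
            ∑ q ∈ ltPairs n, edgeProb κ n x q :=
          Finset.sum_congr rfl fun q _ => by
            rw [sub_zero, abs_of_nonneg (edgeProb_nonneg h0 n x q)]
        rw [h3] at h1
        simp only
        linarith
    _ = f ⊥ + L * (n * B) := by simp

/-- Variance bound for a function of `G_{1/n}(n,κ)` that changes by at most `L` when an
edge is added. -/
lemma sum_graphProb_mul_sub_sq_le {κ : ℝ → ℝ → ℝ} {B : ℝ}
    (hm : Measurable (Function.uncurry κ)) (h0 : ∀ x y, 0 ≤ κ x y) (hB : ∀ x y, κ x y ≤ B)
    {n : ℕ} (hn : 0 < n) {L : ℝ} (hL : 0 ≤ L) {f : SimpleGraph (Fin n) → ℝ}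
    (hf : ∀ a S, |f (graphOf (insert a S)) - f (graphOf S)| ≤ L) :
    ∑ G, graphProb κ n G * (f G - ∑ G', graphProb κ n G' * f G') ^ 2 ≤
      n * L ^ 2 * (B + 4 * B ^ 2) := by
  have := isProbabilityMeasure_restrict_typeCube n
  have := isProbabilityMeasure_restrict_Icc
  set m := ∑ G', graphProb κ n G' * f G' with hmdef
  set g : (Fin n → ℝ) → ℝ := fun x =>
    bernSum (edgeProb κ n x) (ltPairs n) fun S => f (graphOf S) with hg
  have hexp : ∑ G, graphProb κ n G * (f G - m) ^ 2 =
      ∑ G, graphProb κ n G * f G ^ 2 - m ^ 2 := by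
    have : ∀ G, graphProb κ n G * (f G - m) ^ 2 = graphProb κ n G * f G ^ 2
        - 2 * m * (graphProb κ n G * f G) + m ^ 2 * graphProb κ n G := fun G => by ring
    simp_rw [this]
    rw [Finset.sum_add_distrib, Finset.sum_sub_distrib, ← Finset.mul_sum, ← Finset.mul_sum,
      sum_graphProb hm h0, ← hmdef]
    ring
  have hmg : m = ∫ x in typeCube n, g x := sum_graphProb_mul hm h0 n f
  obtain ⟨M, hM⟩ := exists_abs_bernSum_edgeProb_le h0 n f
  have hgm : Measurable g := measurable_bernSum_edgeProb hm n f
  have hlip : ∀ x i t, |g (Function.update x i t) - g x| ≤ L * (2 * B) := fun x i t =>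
    (abs_bernSum_sub_bernSum_le (edgeProb_nonneg h0 n _) (edgeProb_le_one κ n _)
      (edgeProb_nonneg h0 n x) (edgeProb_le_one κ n x) (ltPairs n)
      (f := fun S => f (graphOf S)) hf).trans
      (mul_le_mul_of_nonneg_left (sum_abs_edgeProb_update_sub_le h0 hB hn x i t) hL)
  have hvar := integral_pi_sq_sub_sq_le ((volume : Measure ℝ).restrict (Icc 0 1)) n hgm hM hlip
  rw [← volume_restrict_typeCube, ← hmg] at hvar
  have hg2 : Integrable (fun x => g x ^ 2) (volume.restrict (typeCube n)) := by
    refine .of_bound (hgm.pow_const 2).aestronglyMeasurable (M ^ 2) (ae_of_all _ fun x => ?_)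
    rw [Real.norm_eq_abs, abs_pow]
    exact pow_le_pow_left₀ (abs_nonneg _) (hM x) 2
  have hsecond : ∑ G, graphProb κ n G * f G ^ 2 ≤
      ∫ x in typeCube n, (g x ^ 2 + L ^ 2 * (n * B)) := by
    rw [sum_graphProb_mul hm h0 n fun G => f G ^ 2]
    refine integral_mono (integrable_bernSum_edgeProb hm h0 n fun G => f G ^ 2)
      (hg2.add (integrable_const _)) fun x => ?_
    have h1 := bernSum_sq_sub_sq_le (edgeProb_nonneg h0 n x) (edgeProb_le_one κ n x)
      (ltPairs n) (f := fun S => f (graphOf S)) hf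
    have h2 := mul_le_mul_of_nonneg_left (sum_edgeProb_le h0 hB hn x) (sq_nonneg L)
    simp only [hg]
    linarith
  rw [integral_add hg2 (integrable_const _)] at hsecond
  simp only [integral_const, probReal_univ, smul_eq_mul, one_mul] at hsecond
  rw [hexp]
  linarith

lemma pairCount_insert {n : ℕ} (a : Fin n × Fin n) (S : Finset (Fin n × Fin n))
    (U W : Set (Fin n)) :
    pairCount (graphOf S) U W ≤ pairCount (graphOf (insert a S)) U W ∧
      pairCount (graphOf (insert a S)) U W ≤ pairCount (graphOf S) U W + 2 := by
  have hcount : ∀ G : SimpleGraph (Fin n), pairCount G U W =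
      {p : Fin n × Fin n | p.1 ∈ U ∧ p.2 ∈ W ∧ G.Adj p.1 p.2}.ncard := fun G => rfl
  simp only [hcount]
  constructor
  · refine ncard_le_ncard (fun p hp => ⟨hp.1, hp.2.1, ?_⟩) (toFinite _)
    have h := (graphOf_adj _ _ _).1 hp.2.2
    exact (graphOf_adj _ _ _).2
      ⟨h.1, h.2.imp (Finset.mem_insert_of_mem ·) (Finset.mem_insert_of_mem ·)⟩
  · have hpair : ({a, a.swap} : Set (Fin n × Fin n)).ncard ≤ 2 :=
      (ncard_insert_le _ _).trans (by simp)
    refine le_trans (ncard_le_ncard (t := {p : Fin n × Fin n |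
      p.1 ∈ U ∧ p.2 ∈ W ∧ (graphOf S).Adj p.1 p.2} ∪ {a, a.swap}) (fun p hp => ?_)
      (toFinite _)) ((ncard_union_le _ _).trans (Nat.add_le_add_left hpair _))
    have h := (graphOf_adj _ _ _).1 hp.2.2
    rcases h with ⟨hne, h | h⟩ <;> rcases Finset.mem_insert.1 h with h | h
    · exact Or.inr (Or.inl h)
    · exact Or.inl ⟨hp.1, hp.2.1, (graphOf_adj _ _ _).2 ⟨hne, Or.inl h⟩⟩
    · exact Or.inr (Or.inr (by simp [← h]))
    · exact Or.inl ⟨hp.1, hp.2.1, (graphOf_adj _ _ _).2 ⟨hne, Or.inr h⟩⟩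

lemma IsBalanced.div_le_ncard {n k : ℕ} {P : Fin n → Fin k} (hP : IsBalanced P) (j : Fin k) :
    (n : ℝ) / (2 * k) ≤ (P ⁻¹' {j}).ncard := by
  have hk : (0 : ℝ) < k := by exact_mod_cast j.pos
  have hsum : n = ∑ i : Fin k, (P ⁻¹' {i}).ncard := by
    calc n = (Finset.univ : Finset (Fin n)).card := by simp
      _ = ∑ i : Fin k, (Finset.univ.filter fun v => P v = i).card :=
        Finset.card_eq_sum_card_fiberwise fun _ _ => Finset.mem_coe.2 (Finset.mem_univ _)
      _ = ∑ i : Fin k, (P ⁻¹' {i}).ncard := by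
        refine Finset.sum_congr rfl fun i _ => ?_
        rw [← ncard_coe_finset]
        congr 1
        ext v
        simp
  have hpos : 0 < (P ⁻¹' {j}).ncard := (ncard_pos (toFinite _)).2 (hP.1 j)
  have hle : n ≤ ∑ _i : Fin k, 2 * (P ⁻¹' {j}).ncard := by
    conv_lhs => rw [hsum]
    refine Finset.sum_le_sum fun i _ => ?_
    have := hP.2 i j
    omega
  rw [Finset.sum_const, Finset.card_univ, Fintype.card_fin, smul_eq_mul] at hle
  rw [div_le_iff₀ (by positivity)]
  have : (n : ℝ) ≤ k * (2 * (P ⁻¹' {j}).ncard) := by exact_mod_cast hle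
  linarith

lemma exists_isBalanced {n k : ℕ} (hk : 0 < k) (hn : k ≤ n) :
    ∃ P : Fin n → Fin k, IsBalanced P := by
  refine ⟨fun v => ⟨v % k, Nat.mod_lt _ hk⟩, fun i => ⟨⟨i, i.2.trans_le hn⟩, ?_⟩, ?_⟩
  · simp [Nat.mod_eq_of_lt i.2]
  · have hcard : ∀ i : Fin k,
        ((fun v : Fin n => (⟨v % k, Nat.mod_lt _ hk⟩ : Fin k)) ⁻¹' {i}).ncard =
          n / k + if (i : ℕ) % k < n % k then 1 else 0 := fun i => by
      rw [← Nat.count_modEq_card n hk, Nat.count_eq_card_filter_range, ← ncard_coe_finset,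
        ← ncard_image_of_injective _ Fin.val_injective]
      congr 1
      ext v
      simp only [mem_image, mem_preimage, mem_singleton_iff, Fin.ext_iff, Finset.coe_filter,
        Finset.mem_range, mem_ofPred_eq, Nat.ModEq, Nat.mod_eq_of_lt i.2]
      exact ⟨fun ⟨w, hw, hwv⟩ => hwv ▸ ⟨w.2, hw⟩, fun ⟨hv, h⟩ => ⟨⟨v, hv⟩, h, rfl⟩⟩
    intro i j
    rw [hcard, hcard]
    split_ifs <;> push_cast <;> linarith

lemma dist_partMatrix_insert_le {n k : ℕ} (hn : 0 < n) {P : Fin n → Fin k}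
    (hP : IsBalanced P) (a : Fin n × Fin n) (S : Finset (Fin n × Fin n)) :
    dist (partMatrix (graphOf (insert a S)) P) (partMatrix (graphOf S) P) ≤ 8 * k ^ 2 / n := by
  refine (dist_pi_le_iff (by positivity)).2 fun q => ?_
  have hn' : (0 : ℝ) < n := by exact_mod_cast hn
  have hk : (0 : ℝ) < k := by exact_mod_cast q.val.1.pos
  obtain ⟨h1, h2⟩ := pairCount_insert a S (P ⁻¹' {q.val.1}) (P ⁻¹' {q.val.2})
  have hs := hP.div_le_ncard q.val.1
  have ht := hP.div_le_ncard q.val.2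
  have hpos : 0 < (n : ℝ) / (2 * k) := by positivity
  simp only [partMatrix, Real.dist_eq]
  set s : ℝ := ((P ⁻¹' {q.val.1}).ncard : ℝ)
  set t : ℝ := ((P ⁻¹' {q.val.2}).ncard : ℝ)
  have h1' : (pairCount (graphOf S) (P ⁻¹' {q.val.1}) (P ⁻¹' {q.val.2}) : ℝ) ≤
      pairCount (graphOf (insert a S)) (P ⁻¹' {q.val.1}) (P ⁻¹' {q.val.2}) := by
    exact_mod_cast h1
  have h2' : (pairCount (graphOf (insert a S)) (P ⁻¹' {q.val.1}) (P ⁻¹' {q.val.2}) : ℝ) ≤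
      pairCount (graphOf S) (P ⁻¹' {q.val.1}) (P ⁻¹' {q.val.2}) + 2 := by
    exact_mod_cast h2
  have hst : (n / (2 * k)) * (n / (2 * k)) ≤ s * t := by gcongr
  rw [← sub_div, ← mul_sub, abs_of_nonneg (div_nonneg (mul_nonneg hn'.le (by linarith))
    (mul_nonneg (hpos.le.trans hs) (hpos.le.trans ht)))]
  calc _ ≤ n * 2 / ((n / (2 * k)) * (n / (2 * k)) : ℝ) := by
        gcongr
        linarith
    _ = 8 * k ^ 2 / n := by field_simp; norm_num

lemma finite_Mset (k : ℕ) {n : ℕ} (G : SimpleGraph (Fin n)) : (Mset k G).Finite := by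
  refine (finite_range fun P : Fin n → Fin k => partMatrix G P).subset ?_
  rintro M ⟨P, -, rfl⟩
  exact mem_range_self P

lemma nonempty_Mset {n k : ℕ} (hk : 0 < k) (hn : k ≤ n) (G : SimpleGraph (Fin n)) :
    (Mset k G).Nonempty :=
  let ⟨P, hP⟩ := exists_isBalanced hk hn
  ⟨_, P, hP, rfl⟩

/-- `M_k(G)` as a point of the hyperspace of nonempty compact sets, with the default value
`{0}` when there is no balanced `k`-partition. -/
def compactMset (k : ℕ) {n : ℕ} (G : SimpleGraph (Fin n)) :
    TopologicalSpace.NonemptyCompacts (SymIdx k → ℝ) :=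
  if h : (Mset k G).Nonempty then ⟨⟨Mset k G, (finite_Mset k G).isCompact⟩, h⟩ else {0}

lemma coe_compactMset {n k : ℕ} (hk : 0 < k) (hn : k ≤ n) (G : SimpleGraph (Fin n)) :
    (compactMset k G : Set (SymIdx k → ℝ)) = Mset k G := by
  rw [compactMset, dif_pos (nonempty_Mset hk hn G)]
  rfl

lemma dist_compactMset_insert_le {n k : ℕ} (hk : 0 < k) (hn : k ≤ n) (a : Fin n × Fin n)
    (S : Finset (Fin n × Fin n)) :
    dist (compactMset k (graphOf (insert a S))) (compactMset k (graphOf S)) ≤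
      8 * k ^ 2 / n := by
  rw [Metric.NonemptyCompacts.dist_eq, coe_compactMset hk hn, coe_compactMset hk hn]
  refine Metric.hausdorffDist_le_of_mem_dist (by positivity) ?_ ?_
  · rintro M ⟨P, hP, rfl⟩
    exact ⟨_, ⟨P, hP, rfl⟩, dist_partMatrix_insert_le (hk.trans_le hn) hP a S⟩
  · rintro M ⟨P, hP, rfl⟩
    refine ⟨_, ⟨P, hP, rfl⟩, ?_⟩
    rw [dist_comm]
    exact dist_partMatrix_insert_le (hk.trans_le hn) hP a S

lemma compactMset_bot {n k : ℕ} :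
    compactMset k (⊥ : SimpleGraph (Fin n)) = {0} := by
  unfold compactMset
  split_ifs with h
  · have hzero : ∀ P : Fin n → Fin k, partMatrix (⊥ : SimpleGraph (Fin n)) P = 0 := fun P => by
      funext q
      simp [partMatrix, pairCount]
    refine TopologicalSpace.NonemptyCompacts.ext ?_
    change Mset k (⊥ : SimpleGraph (Fin n)) = {0}
    refine Subset.antisymm ?_ ?_
    · rintro M ⟨P, -, rfl⟩
      exact hzero P
    · obtain ⟨M, P, hP, -⟩ := h
      rintro M rfl
      exact ⟨P, hP, (hzero P).symm⟩
  · rfl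

lemma totallyBounded_closedBall_singleton {α : Type*} [MetricSpace α] [ProperSpace α] (a : α)
    (K : ℝ) :
    TotallyBounded (Metric.closedBall ({a} : TopologicalSpace.NonemptyCompacts α) K) := by
  have htb := TopologicalSpace.NonemptyCompacts.totallyBounded_subsets_of_totallyBounded
    (isCompact_closedBall a (K + 1)).totallyBounded
  refine TotallyBounded.subset ?_ htb
  intro A hA x hx
  have hA' := Metric.mem_closedBall.1 hA
  rw [Metric.NonemptyCompacts.dist_eq] at hA'
  obtain ⟨y, hy, hxy⟩ := Metric.exists_dist_lt_of_hausdorffDist_lt hx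
    (hA'.trans_lt (lt_add_one K)) (Metric.hausdorffEDist_ne_top_of_nonempty_of_bounded
      A.nonempty (singleton_nonempty a) A.isCompact.isBounded Bornology.isBounded_singleton)
  rw [← (show y = a from hy)]
  exact Metric.mem_closedBall.2 hxy.le

/-- With `p = 1/n`: let `κ` be a bounded kernel, `k ≥ 2` fixed, and
`G_n = G_{1/n}(n,κ)`.  Then for each `n` there is a deterministic nonempty compact set
`Y_n ⊆ ℝ^{k(k+1)/2}` such that `d_H(M_k(G_n), Y_n) → 0` in probability, i.e. for every
`ε > 0` the probability that `d_H(M_k(G_n), Y_n) > ε` tends to `0`. -/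
theorem partition_matrices_concentrate
    (κ : ℝ → ℝ → ℝ)
    (hκ : Measurable (Function.uncurry κ) ∧ (∀ x y, κ x y = κ y x) ∧ (∀ x y, 0 ≤ κ x y))
    (hbdd : ∃ B : ℝ, ∀ x y, κ x y ≤ B)
    (k : ℕ) (hk : 2 ≤ k) :
    ∃ Y : (n : ℕ) → Set (SymIdx k → ℝ),
      (∀ n, (Y n).Nonempty ∧ IsCompact (Y n)) ∧
      ∀ ε : ℝ, 0 < ε →
        Tendsto (fun n : ℕ =>
            gProb κ n {G | ε < Metric.hausdorffDist (Mset k G) (Y n)})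
          atTop (nhds 0) := by
  obtain ⟨hm, -, h0⟩ := hκ
  obtain ⟨B, hB⟩ := hbdd
  have hk0 : 0 < k := by omega
  have hlip : ∀ {n : ℕ}, k ≤ n → ∀ z a (S : Finset (Fin n × Fin n)),
      |dist (compactMset k (graphOf (insert a S))) z - dist (compactMset k (graphOf S)) z| ≤
        8 * k ^ 2 / n := fun hn z a S =>
    (abs_dist_sub_le _ _ _).trans (dist_compactMset_insert_le hk0 hn a S)
  have hT : ∃ C, ∀ᶠ n in atTop, ∑ G : SimpleGraph (Fin n),
      graphProb κ n G * dist (compactMset k G) {0} ≤ C := by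
    refine ⟨8 * k ^ 2 * B, ?_⟩
    filter_upwards [eventually_ge_atTop k] with n hn
    have hn' : (n : ℝ) ≠ 0 := by exact_mod_cast (hk0.trans_le hn).ne'
    refine (sum_graphProb_mul_le hm h0 hB (hk0.trans_le hn) (by positivity)
      (f := fun G => dist (compactMset k G) {0}) (hlip hn _)).trans (le_of_eq ?_)
    rw [compactMset_bot, dist_self]
    field_simp
    ring
  have hc : ∀ z, ∃ m : ℕ → ℝ, Tendsto (fun n => ∑ G : SimpleGraph (Fin n),
      graphProb κ n G * (dist (compactMset k G) z - m n) ^ 2) atTop (nhds 0) := by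
    intro z
    refine ⟨fun n => ∑ G, graphProb κ n G * dist (compactMset k G) z, ?_⟩
    have hlim : Tendsto (fun n : ℕ => (8 * k ^ 2) ^ 2 * (B + 4 * B ^ 2) / (n : ℝ)) atTop
        (nhds 0) := tendsto_const_div_atTop_nhds_zero_nat _
    refine tendsto_of_tendsto_of_tendsto_of_le_of_le' tendsto_const_nhds hlim
      (Eventually.of_forall fun n => Finset.sum_nonneg fun G _ =>
        mul_nonneg (graphProb_nonneg h0 n G) (sq_nonneg _)) ?_
    filter_upwards [eventually_ge_atTop k] with n hn
    have hn' : (n : ℝ) ≠ 0 := by exact_mod_cast (hk0.trans_le hn).ne'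
    refine (sum_graphProb_mul_sub_sq_le hm h0 hB (hk0.trans_le hn) (by positivity)
      (f := fun G => dist (compactMset k G) z) (hlip hn _)).trans (le_of_eq ?_)
    field_simp
  obtain ⟨Y, hY⟩ := exists_tendsto_sum_dist (Ω := fun n => SimpleGraph (Fin n))
    ({0} : TopologicalSpace.NonemptyCompacts (SymIdx k → ℝ))
    (totallyBounded_closedBall_singleton 0) (w := graphProb κ) (graphProb_nonneg h0)
    (sum_graphProb hm h0) (fun n G => compactMset k G) hT hc
  refine ⟨fun n => Y n, fun n => ⟨(Y n).nonempty, (Y n).isCompact⟩, fun ε hε => ?_⟩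
  refine (hY ε hε).congr' ?_
  filter_upwards [eventually_ge_atTop k] with n hn
  rw [gProb_eq_sum hm h0]
  refine Finset.sum_congr (Finset.filter_congr fun G _ => ?_) fun _ _ => rfl
  rw [Metric.NonemptyCompacts.dist_eq, coe_compactMset hk0 hn, mem_ofPred_eq]
end
end

section
/- Let 0 < a < b and c > 0 be constants and let 0 < δ < b − a. Then there is a constant K = K(a,b,c,δ) such that for every n and every graph H with ⌊an⌋ vertices and at least bn edges, the probability that the random graph G(n, c/n) contains all but at most δn edges of some copy of H (i.e. contains a subgraph obtained from a graph H' on {1,…,n} isomorphic to H by deleting at most δn edges) is at most n^{(a−b+δ)n}·K^n. In particular, since a − b + δ < 0, this probability tends to 0 as n → ∞. -/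
open Filter

noncomputable section
open scoped Classical

/-- The probability that the Erdős–Rényi random graph `G(n,p)` (each of the
`n(n-1)/2` possible edges present independently with probability `p`) equals a
given graph `G` on `{1,…,n}`. -/
def erProb (n : ℕ) (p : ℝ) (G : SimpleGraph (Fin n)) : ℝ :=
  p ^ (Nat.card G.edgeSet) * (1 - p) ^ (n.choose 2 - Nat.card G.edgeSet)

/-- `G` contains all but at most `d` edges of some copy of `H` in `{1,…,n}`: there is an
injection `φ` of the vertices of `H` into those of `G` such that at most `d` edges of
`H` fail to map to edges of `G`. -/
def ContainsAllBut {m n : ℕ} (H : SimpleGraph (Fin m)) (G : SimpleGraph (Fin n))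
    (d : ℝ) : Prop :=
  ∃ φ : Fin m → Fin n, Function.Injective φ ∧
    (Set.ncard {e : Sym2 (Fin m) | e ∈ H.edgeSet ∧ Sym2.map φ e ∉ G.edgeSet} : ℝ) ≤ d

lemma sum_biUnion_le_of_nonneg_s9 {ι α : Type*} (s : Finset ι) (t : ι → Finset α) {f : α → ℝ}
    (hf : ∀ x, 0 ≤ f x) : ∑ x ∈ s.biUnion t, f x ≤ ∑ i ∈ s, ∑ x ∈ t i, f x := by
  induction s using Finset.induction_on with
  | empty => simp
  | insert i s hi ih =>
    rw [Finset.biUnion_insert, Finset.sum_insert hi]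
    have h := Finset.sum_union_inter (s₁ := t i) (s₂ := s.biUnion t) (f := f)
    have h0 : 0 ≤ ∑ x ∈ t i ∩ s.biUnion t, f x := Finset.sum_nonneg fun x _ => hf x
    linarith

lemma erProb_nonneg {n : ℕ} {p : ℝ} (hp0 : 0 ≤ p) (hp1 : p ≤ 1) (G : SimpleGraph (Fin n)) :
    0 ≤ erProb n p G :=
  mul_nonneg (pow_nonneg hp0 _) (pow_nonneg (sub_nonneg.2 hp1) _)

/-- The probability that `G(n,p)` contains a given set `F` of edges is `p ^ #F`. -/
lemma sum_erProb_filter_subset_edgeSet {n : ℕ} (p : ℝ) (F : Finset (Sym2 (Fin n)))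
    (hF : ∀ e ∈ F, ¬ e.IsDiag) :
    ∑ G ∈ Finset.univ.filter (fun G : SimpleGraph (Fin n) => (F : Set (Sym2 (Fin n))) ⊆ G.edgeSet),
      erProb n p G = p ^ F.card := by
  set E : Finset (Sym2 (Fin n)) := (⊤ : SimpleGraph (Fin n)).edgeFinset with hE
  have hEcard : E.card = n.choose 2 := by
    rw [hE, SimpleGraph.card_edgeFinset_top_eq_card_choose_two, Fintype.card_fin]
  have hFE : F ⊆ E := fun e he => by
    simpa [hE, SimpleGraph.edgeSet_top] using hF e he
  have hone : ∑ B ∈ (E \ F).powerset, p ^ B.card * (1 - p) ^ ((E \ F).card - B.card) = 1 := by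
    rw [Finset.sum_pow_mul_eq_add_pow]; simp
  rw [← mul_one (p ^ F.card), ← hone, Finset.mul_sum]
  refine Finset.sum_nbij' (fun G => G.edgeFinset \ F)
    (fun B => SimpleGraph.fromEdgeSet ((B ∪ F : Finset (Sym2 (Fin n))) : Set (Sym2 (Fin n))))
    ?_ ?_ ?_ ?_ ?_
  · intro G _
    rw [Finset.mem_powerset]
    exact Finset.sdiff_subset_sdiff (SimpleGraph.edgeFinset_mono le_top) subset_rfl
  · intro B _
    simp only [Finset.mem_filter, Finset.mem_univ, true_and, SimpleGraph.edgeSet_fromEdgeSet]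
    intro e he
    exact ⟨by simpa using Or.inr he, hF e he⟩
  · intro G hG
    simp only [Finset.mem_filter, Finset.mem_univ, true_and] at hG
    rw [Finset.sdiff_union_of_subset (fun e he => by simpa using hG he)]
    simp
  · intro B hB
    rw [Finset.mem_powerset] at hB
    ext e
    simp only [Finset.mem_sdiff, SimpleGraph.mem_edgeFinset, SimpleGraph.edgeSet_fromEdgeSet,
      Set.mem_sdiff, Finset.mem_coe, Finset.mem_union]
    constructor
    · tauto
    · intro he
      have h := Finset.mem_sdiff.1 (hB he)
      refine ⟨⟨Or.inl he, ?_⟩, h.2⟩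
      simpa [hE, SimpleGraph.edgeSet_top] using h.1
  · intro G hG
    simp only [Finset.mem_filter, Finset.mem_univ, true_and] at hG
    have hsub : F ⊆ G.edgeFinset := fun e he => by simpa using hG he
    have hc : Nat.card G.edgeSet = G.edgeFinset.card := by
      rw [Nat.card_eq_fintype_card, SimpleGraph.edgeFinset_card]
    have h1 := Finset.card_sdiff_add_card_eq_card hsub
    have h2 := Finset.card_sdiff_add_card_eq_card hFE
    rw [erProb, hc, ← mul_assoc, ← pow_add]
    congr 2 <;> omega

/-- Passing to a set `T` of edges of `H`, a graph containing all but at most `d` edges of a copy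
of `H` contains the image of a subset of `T` of size at least `#T - d`. -/
lemma ContainsAllBut.exists_subset {m n : ℕ} {H : SimpleGraph (Fin m)} {G : SimpleGraph (Fin n)}
    {d : ℝ} (h : ContainsAllBut H G d) (T : Finset (Sym2 (Fin m))) (hT : T ⊆ H.edgeFinset) :
    ∃ φ : Fin m → Fin n, Function.Injective φ ∧ ∃ S ⊆ T, (T.card : ℝ) - d ≤ S.card ∧
      ((S.image (Sym2.map φ) : Finset _) : Set (Sym2 (Fin n))) ⊆ G.edgeSet := by
  obtain ⟨φ, hφ, hd⟩ := h
  refine ⟨φ, hφ, T.filter (fun e => Sym2.map φ e ∈ G.edgeSet), Finset.filter_subset _ _, ?_, ?_⟩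
  · have hle : (T.filter (fun e => ¬ Sym2.map φ e ∈ G.edgeSet)).card ≤
        Set.ncard {e : Sym2 (Fin m) | e ∈ H.edgeSet ∧ Sym2.map φ e ∉ G.edgeSet} := by
      rw [← Set.ncard_coe_finset]
      refine Set.ncard_le_ncard (fun e he => ?_) (Set.toFinite _)
      simp only [Finset.coe_filter, Set.mem_ofPred_eq] at he
      exact ⟨by simpa using hT he.1, he.2⟩
    have hsum := Finset.card_filter_add_card_filter_not (s := T)
      (fun e => Sym2.map φ e ∈ G.edgeSet)
    have hle' : ((T.filter (fun e => ¬ Sym2.map φ e ∈ G.edgeSet)).card : ℝ) ≤ d :=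
      le_trans (by exact_mod_cast hle) hd
    have hsum' : ((T.filter (fun e => Sym2.map φ e ∈ G.edgeSet)).card : ℝ) +
        (T.filter (fun e => ¬ Sym2.map φ e ∈ G.edgeSet)).card = T.card := by exact_mod_cast hsum
    linarith
  · intro e he
    simp only [Finset.coe_image, Set.mem_image, Finset.mem_coe, Finset.mem_filter] at he
    obtain ⟨x, hx, rfl⟩ := he
    exact hx.2

/-- The union bound over injections `φ` and over the subsets of a set `T` of edges of `H`. -/
lemma sum_erProb_containsAllBut_le {m n : ℕ} {p d r : ℝ} (hp0 : 0 < p) (hp1 : p ≤ 1)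
    (H : SimpleGraph (Fin m)) (T : Finset (Sym2 (Fin m))) (hT : T ⊆ H.edgeFinset)
    (hr : r ≤ T.card - d) :
    ∑ G ∈ Finset.univ.filter (fun G : SimpleGraph (Fin n) => ContainsAllBut H G d), erProb n p G
      ≤ (n : ℝ) ^ m * 2 ^ T.card * p ^ r := by
  set I : Finset ((Fin m → Fin n) × Finset (Sym2 (Fin m))) :=
    ((Finset.univ.filter fun φ : Fin m → Fin n => Function.Injective φ) ×ˢ
      T.powerset.filter fun S => (T.card : ℝ) - d ≤ S.card) with hI
  have hsub : Finset.univ.filter (fun G : SimpleGraph (Fin n) => ContainsAllBut H G d) ⊆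
      I.biUnion fun x => Finset.univ.filter fun G : SimpleGraph (Fin n) =>
        ((x.2.image (Sym2.map x.1) : Finset _) : Set (Sym2 (Fin n))) ⊆ G.edgeSet := by
    intro G hG
    obtain ⟨φ, hφ, S, hST, hS, hSG⟩ := (Finset.mem_filter.1 hG).2.exists_subset T hT
    refine Finset.mem_biUnion.2 ⟨(φ, S), ?_, Finset.mem_filter.2 ⟨Finset.mem_univ _, hSG⟩⟩
    simp only [hI, Finset.mem_product, Finset.mem_filter, Finset.mem_univ, true_and,
      Finset.mem_powerset]
    exact ⟨hφ, hST, hS⟩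
  have hterm : ∀ x ∈ I, ∑ G ∈ Finset.univ.filter (fun G : SimpleGraph (Fin n) =>
      ((x.2.image (Sym2.map x.1) : Finset _) : Set (Sym2 (Fin n))) ⊆ G.edgeSet),
        erProb n p G ≤ p ^ r := by
    rintro ⟨φ, S⟩ hx
    simp only [hI, Finset.mem_product, Finset.mem_filter, Finset.mem_univ, true_and,
      Finset.mem_powerset] at hx
    obtain ⟨hφ, hST, hS⟩ := hx
    rw [sum_erProb_filter_subset_edgeSet, Finset.card_image_of_injective _ (Sym2.map.injective hφ),
      ← Real.rpow_natCast]
    · exact Real.rpow_le_rpow_of_exponent_ge hp0 hp1 (hr.trans hS)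
    · intro e he
      obtain ⟨x, hxS, rfl⟩ := Finset.mem_image.1 he
      rw [Sym2.isDiag_map hφ]
      exact H.not_isDiag_of_mem_edgeSet (by simpa using hT (hST hxS))
  have hcard : (I.card : ℝ) ≤ (n : ℝ) ^ m * 2 ^ T.card := by
    have h1 : I.card ≤ n ^ m * 2 ^ T.card := by
      rw [hI, Finset.card_product]
      refine Nat.mul_le_mul ((Finset.card_filter_le _ _).trans (by simp))
        ((Finset.card_filter_le _ _).trans (by simp))
    exact_mod_cast h1
  calc _ ≤ ∑ G ∈ I.biUnion fun x => Finset.univ.filter fun G : SimpleGraph (Fin n) =>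
        ((x.2.image (Sym2.map x.1) : Finset _) : Set (Sym2 (Fin n))) ⊆ G.edgeSet, erProb n p G :=
        Finset.sum_le_sum_of_subset_of_nonneg hsub fun G _ _ => erProb_nonneg hp0.le hp1 G
    _ ≤ ∑ x ∈ I, ∑ G ∈ Finset.univ.filter (fun G : SimpleGraph (Fin n) =>
        ((x.2.image (Sym2.map x.1) : Finset _) : Set (Sym2 (Fin n))) ⊆ G.edgeSet),
          erProb n p G := sum_biUnion_le_of_nonneg_s9 _ _ (erProb_nonneg hp0.le hp1)
    _ ≤ I.card • p ^ r := Finset.sum_le_card_nsmul _ _ _ hterm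
    _ ≤ _ := by
        rw [nsmul_eq_mul]
        exact mul_le_mul_of_nonneg_right hcard (Real.rpow_nonneg hp0.le _)

/-- Let `0 < a < b`, `c > 0` and `0 < δ < b − a`.  Then there is a
constant `K = K(a,b,c,δ) > 0` such that for every `n` and every graph `H` with `⌊an⌋`
vertices and at least `bn` edges, the probability that `G(n, c/n)` contains all but at
most `δn` edges of some copy of `H` is at most `n^{(a−b+δ)n}·Kⁿ` (which tends to `0`
as `n → ∞`, since `a − b + δ < 0`). -/
theorem prob_contains_most_of_dense_graph_le
    (a b c δ : ℝ) (ha : 0 < a) (hab : a < b) (hc : 0 < c)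
    (hδ : 0 < δ) (hδ' : δ < b - a) :
    ∃ K : ℝ, 0 < K ∧ ∀ n : ℕ, ∀ H : SimpleGraph (Fin ⌊a * (n : ℝ)⌋₊),
      b * n ≤ (Nat.card H.edgeSet : ℝ) →
      (∑ G ∈ Finset.univ.filter
          (fun G : SimpleGraph (Fin n) => ContainsAllBut H G (δ * n)),
            erProb n (c / n) G)
        ≤ (n : ℝ) ^ ((a - b + δ) * (n : ℝ)) * K ^ n := by
  set M : ℕ → ℝ := fun n => (n : ℝ) ^ (-((a - b + δ) * (n : ℝ))) *
    ∑ G : SimpleGraph (Fin n), |erProb n (c / n) G| with hM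
  have hM0 : ∀ n, 0 ≤ M n := fun n => by positivity
  set K₁ : ℝ := 1 + ∑ n ∈ Finset.range ⌈c⌉₊, M n with hK₁
  set K₂ : ℝ := 2 ^ (b + 1) * c ^ (b - δ) with hK₂
  have hK₁1 : 1 ≤ K₁ := le_add_of_nonneg_right (Finset.sum_nonneg fun n _ => hM0 n)
  have hK₂0 : 0 < K₂ := by positivity
  refine ⟨max K₁ K₂, lt_max_of_lt_right hK₂0, fun n H hH => ?_⟩
  rcases Nat.eq_zero_or_pos n with rfl | hn
  · calc _ ≤ ∑ G : SimpleGraph (Fin 0), erProb 0 (c / (0 : ℕ)) G :=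
          Finset.sum_le_sum_of_subset_of_nonneg (Finset.filter_subset _ _)
            fun G _ _ => erProb_nonneg (by simp) (by simp) G
      _ = 1 := by simpa using sum_erProb_filter_subset_edgeSet (n := 0) (c / (0 : ℕ)) ∅ (by simp)
      _ ≤ _ := by simp
  have hn0 : (0 : ℝ) < n := by exact_mod_cast hn
  rcases lt_or_ge (n : ℝ) c with hnc | hnc
  · have hle : M n ≤ K₁ :=
      (Finset.single_le_sum (fun i _ => hM0 i)
        (Finset.mem_range.2 (Nat.lt_ceil.2 hnc))).trans (le_add_of_nonneg_left zero_le_one)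
    have hKn : M n ≤ max K₁ K₂ ^ n :=
      hle.trans ((le_max_left _ _).trans
        (le_self_pow₀ (hK₁1.trans (le_max_left _ _)) hn.ne'))
    calc _ ≤ ∑ G ∈ Finset.univ.filter
            (fun G : SimpleGraph (Fin n) => ContainsAllBut H G (δ * n)), |erProb n (c / n) G| :=
          Finset.sum_le_sum fun G _ => le_abs_self _
      _ ≤ ∑ G : SimpleGraph (Fin n), |erProb n (c / n) G| :=
          Finset.sum_le_sum_of_subset_of_nonneg (Finset.filter_subset _ _)
            fun G _ _ => abs_nonneg _
      _ = (n : ℝ) ^ ((a - b + δ) * (n : ℝ)) * M n := by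
          rw [hM, ← mul_assoc, ← Real.rpow_add hn0, add_neg_cancel, Real.rpow_zero, one_mul]
      _ ≤ _ := mul_le_mul_of_nonneg_left hKn (Real.rpow_nonneg hn0.le _)
  · have hcard : ⌈b * n⌉₊ ≤ H.edgeFinset.card := by
      rw [SimpleGraph.edgeFinset_card, ← Nat.card_eq_fintype_card]
      exact Nat.ceil_le.2 hH
    obtain ⟨T, hT, hTc⟩ := Finset.exists_subset_card_eq hcard
    have hT1 : b * n ≤ T.card := hTc ▸ Nat.le_ceil _
    have hT2 : (T.card : ℝ) ≤ (b + 1) * n := by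
      have h1 := (Nat.ceil_lt_add_one (mul_pos (ha.trans hab) hn0).le).le
      have h2 : (1 : ℝ) ≤ n := by exact_mod_cast hn
      rw [hTc]; linarith
    have hn1 : (1 : ℝ) ≤ n := by exact_mod_cast hn
    have hbound := sum_erProb_containsAllBut_le (n := n) (d := δ * n) (r := (b - δ) * n)
      (div_pos hc hn0) ((div_le_one hn0).2 hnc) H T hT (by linarith)
    have hA : (n : ℝ) ^ ⌊a * (n : ℝ)⌋₊ ≤ (n : ℝ) ^ (a * n) := by
      rw [← Real.rpow_natCast]
      exact Real.rpow_le_rpow_of_exponent_le hn1 (Nat.floor_le (by positivity))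
    have hB : (2 : ℝ) ^ T.card ≤ (2 : ℝ) ^ ((b + 1) * n) := by
      rw [← Real.rpow_natCast]
      exact Real.rpow_le_rpow_of_exponent_le one_le_two hT2
    have hC : (c / n) ^ ((b - δ) * n) = c ^ ((b - δ) * n) * (n : ℝ) ^ (-((b - δ) * n)) := by
      rw [Real.div_rpow hc.le hn0.le, Real.rpow_neg hn0.le, div_eq_mul_inv]
    calc _ ≤ _ := hbound
      _ ≤ (n : ℝ) ^ (a * n) * (2 : ℝ) ^ ((b + 1) * n) *
          (c ^ ((b - δ) * n) * (n : ℝ) ^ (-((b - δ) * n))) := by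
          rw [hC]; gcongr
      _ = (n : ℝ) ^ ((a - b + δ) * (n : ℝ)) * K₂ ^ n := by
          have h : (a - b + δ) * (n : ℝ) = a * n + -((b - δ) * n) := by ring
          rw [h, Real.rpow_add hn0, hK₂, mul_pow, ← Real.rpow_mul_natCast zero_le_two,
            ← Real.rpow_mul_natCast hc.le]
          ring
      _ ≤ _ := by
          gcongr
          exact le_max_right _ _
end
end

section
/- Let P and Q be probability measures on [0,∞) each supported on a finite set, and suppose that their mixed Poisson distributions coincide: for every nonnegative integer k, Σ_λ P({λ})·λ^k e^{−λ}/k! = Σ_λ Q({λ})·λ^k e^{−λ}/k!, where the sums run over the (finitely many) atoms of P and Q respectively (with the convention λ^0 e^{−λ} = e^{−λ}, and an atom at 0 contributing e^0·0^k/k! = 1 if k = 0 and 0 otherwise). Then P = Q. -/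
noncomputable section

/-- A finitely supported signed weight on a field is determined by its power moments. -/
theorem eq_zero_of_forall_sum_mul_pow_eq_zero {F : Type*} [Field F] (s : Finset F) (w : F → F)
    (h : ∀ k : ℕ, ∑ x ∈ s, w x * x ^ k = 0) : ∀ x ∈ s, w x = 0 := by
  classical
  have hpoly (p : Polynomial F) : ∑ x ∈ s, w x * p.eval x = 0 := by
    simp_rw [Polynomial.eval_eq_sum_range, Finset.mul_sum]
    rw [Finset.sum_comm]
    refine Finset.sum_eq_zero fun k _ => ?_
    simp only [mul_left_comm (w _) (p.coeff k)]
    rw [← Finset.mul_sum, h k, mul_zero]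
  intro x hx
  have hsum := hpoly (Lagrange.basis s id x)
  rw [Finset.sum_eq_single_of_mem x hx] at hsum
  · have hbasis := Lagrange.eval_basis_self (v := id) Function.injective_id.injOn hx
    rw [id_eq] at hbasis
    rwa [hbasis, mul_one] at hsum
  · intro y hy hyx
    have hbasis := Lagrange.eval_basis_of_ne (v := id) (Ne.symm hyx) hy
    rw [id_eq] at hbasis
    rw [hbasis, mul_zero]

/-- Let `P` and `Q` be probability measures on `[0,∞)`, each supported
on a finite set (represented here by their weight functions `P Q : ℝ → ℝ` with finite
support contained in `[0,∞)`, nonnegative weights summing to `1`).  If their mixed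
Poisson distributions coincide, i.e. for every `k : ℕ`
`Σ_λ P(λ)·λᵏe^{−λ}/k! = Σ_λ Q(λ)·λᵏe^{−λ}/k!`
(with the convention `0⁰ = 1`, so an atom at `0` contributes exactly to `k = 0`),
then `P = Q`. -/
theorem mixed_poisson_determines_finitely_supported_measure
    (P Q : ℝ → ℝ)
    (hPfin : (Function.support P).Finite) (hQfin : (Function.support Q).Finite)
    (hPnn : ∀ l, 0 ≤ P l) (hQnn : ∀ l, 0 ≤ Q l)
    (hPsupp : ∀ l, P l ≠ 0 → 0 ≤ l) (hQsupp : ∀ l, Q l ≠ 0 → 0 ≤ l)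
    (hPsum : ∑ᶠ l, P l = 1) (hQsum : ∑ᶠ l, Q l = 1)
    (h : ∀ k : ℕ, ∑ᶠ l : ℝ, P l * (l ^ k * Real.exp (-l) / (Nat.factorial k)) =
      ∑ᶠ l : ℝ, Q l * (l ^ k * Real.exp (-l) / (Nat.factorial k))) :
    P = Q := by
  classical
  set s := hPfin.toFinset ∪ hQfin.toFinset with hs
  have hsum (R : ℝ → ℝ) (hR : Function.support R ⊆ s) (k : ℕ) :
      ∑ᶠ l : ℝ, R l * (l ^ k * Real.exp (-l) / (Nat.factorial k)) =
        ∑ l ∈ s, R l * (l ^ k * Real.exp (-l) / (Nat.factorial k)) :=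
    finsum_eq_sum_of_support_subset _ ((Function.support_mul_subset_left _ _).trans hR)
  have hPs : Function.support P ⊆ s := by simp [hs]
  have hQs : Function.support Q ⊆ s := by simp [hs]
  have hzero := eq_zero_of_forall_sum_mul_pow_eq_zero s (fun l => (P l - Q l) * Real.exp (-l)) <| by
    intro k
    have hk := h k
    rw [hsum P hPs, hsum Q hQs, ← sub_eq_zero, ← Finset.sum_sub_distrib] at hk
    have hfact : (Nat.factorial k : ℝ) ≠ 0 := by positivity
    rw [← mul_zero (Nat.factorial k : ℝ), ← hk, Finset.mul_sum]
    refine Finset.sum_congr rfl fun l _ => ?_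
    field_simp
  funext l
  by_cases hl : l ∈ s
  · simpa [Real.exp_ne_zero, sub_eq_zero] using hzero l hl
  · rw [Function.notMem_support.mp fun hP => hl (hPs hP),
      Function.notMem_support.mp fun hQ => hl (hQs hQ)]
end
end

section
/- Fix p = 1/n. Let κ be a kernel with ∫κ < ∞, and let (G_n) be a sequence of graphs with |G_n| = n such that the maximum size of a matching in G_n is o(n). Then liminf_{n→∞} d_□(κ_{G_n}, κ) ≥ ∫_{[0,1]²} κ. -/
open MeasureTheory Set Filter

noncomputable section
open scoped Classical

/-- The kernel `κ_G : [0,1]² → [0,∞)` associated to a graph `G` on `n` vertices,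
with normalizing function `p = 1/n`: it takes the constant value `n` on
`I_i × I_j` whenever `ij` is an edge of `G`, and `0` otherwise; here vertices
are indexed from `0`, so `I_i = (i/n, (i+1)/n]`. -/
def graphKernel (n : ℕ) (G : SimpleGraph (Fin n)) (x y : ℝ) : ℝ :=
  if ∃ i j : Fin n, G.Adj i j ∧ x ∈ Set.Ioc ((i : ℝ) / n) (((i : ℝ) + 1) / n) ∧
      y ∈ Set.Ioc ((j : ℝ) / n) (((j : ℝ) + 1) / n) then (n : ℝ) else 0

/-- The cut norm `‖W‖_□ = sup_{S,T ⊆ [0,1] measurable} |∫_{S×T} W|`. -/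
def cutNorm (W : ℝ → ℝ → ℝ) : ℝ :=
  sSup { r : ℝ | ∃ S T : Set ℝ, MeasurableSet S ∧ MeasurableSet T ∧
    S ⊆ Set.Icc 0 1 ∧ T ⊆ Set.Icc 0 1 ∧ r = |∫ x in S, ∫ y in T, W x y| }

/-- `τ` is a measure-preserving bijection of `[0,1]`. -/
def IsMPBij (τ : ℝ → ℝ) : Prop :=
  Set.BijOn τ (Set.Icc 0 1) (Set.Icc 0 1) ∧
    MeasurePreserving τ (volume.restrict (Set.Icc (0:ℝ) 1))
      (volume.restrict (Set.Icc (0:ℝ) 1))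

/-- The cut metric `d_□(κ₁, κ₂) = inf_τ ‖κ₁ - κ₂^{(τ)}‖_□`, the infimum over all
measure-preserving bijections `τ` of `[0,1]`, where `κ₂^{(τ)}(x,y) = κ₂(τ(x), τ(y))`. -/
def cutDist (κ₁ κ₂ : ℝ → ℝ → ℝ) : ℝ :=
  sInf { r : ℝ | ∃ τ : ℝ → ℝ, IsMPBij τ ∧
    r = cutNorm (fun x y => κ₁ x y - κ₂ (τ x) (τ y)) }

/-- `κ` is a kernel: a symmetric, measurable, nonnegative function on `[0,1]²`,
integrable on `[0,1]²` (so `∫ κ < ∞`). -/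
def IsKernel (κ : ℝ → ℝ → ℝ) : Prop :=
  Measurable (Function.uncurry κ) ∧ (∀ x y, κ x y = κ y x) ∧ (∀ x y, 0 ≤ κ x y) ∧
    IntegrableOn (Function.uncurry κ) (Set.Icc 0 1 ×ˢ Set.Icc 0 1)

/-- `G` contains a matching (a set of pairwise vertex-disjoint edges) of size `m`. -/
def HasMatching {n : ℕ} (G : SimpleGraph (Fin n)) (m : ℕ) : Prop :=
  ∃ u w : Fin m → Fin n, Function.Injective u ∧ Function.Injective w ∧
    (∀ i j, u i ≠ w j) ∧ ∀ i, G.Adj (u i) (w i)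

/-- The maximum size of a matching in `G`. -/
def matchNum {n : ℕ} (G : SimpleGraph (Fin n)) : ℕ :=
  sSup {m : ℕ | HasMatching G m}

/-- The points of `[0,1]` outside the intervals `I_i` with `i ∈ C`. -/
def uncovered {n : ℕ} (C : Finset (Fin n)) : Set ℝ :=
  Set.Icc 0 1 \ ⋃ i ∈ C, Set.Ioc ((i : ℝ) / n) (((i : ℝ) + 1) / n)

lemma measurableSet_uncovered {n : ℕ} (C : Finset (Fin n)) : MeasurableSet (uncovered C) :=
  measurableSet_Icc.diff (C.measurableSet_biUnion fun _ _ => measurableSet_Ioc)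

/-- The endpoints of a maximum matching form a vertex cover. -/
lemma exists_cover_card_le {n : ℕ} (G : SimpleGraph (Fin n)) :
    ∃ C : Finset (Fin n), C.card ≤ 2 * matchNum G ∧ ∀ i j, G.Adj i j → i ∈ C ∨ j ∈ C := by
  have hbdd : BddAbove {m : ℕ | HasMatching G m} := by
    refine ⟨n, ?_⟩
    rintro m ⟨u, _, hu, -⟩
    simpa using Fintype.card_le_of_injective u hu
  have hne : {m : ℕ | HasMatching G m}.Nonempty :=
    ⟨0, Fin.elim0, Fin.elim0, fun i => i.elim0, fun i => i.elim0, fun i => i.elim0,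
      fun i => i.elim0⟩
  obtain ⟨u, w, hu, hw, huw, hadj⟩ : HasMatching G (matchNum G) := Nat.sSup_mem hne hbdd
  refine ⟨Finset.univ.image u ∪ Finset.univ.image w, ?_, ?_⟩
  · refine (Finset.card_union_le _ _).trans ?_
    have h₁ := Finset.card_image_le (s := Finset.univ) (f := u)
    have h₂ := Finset.card_image_le (s := Finset.univ) (f := w)
    simp only [Finset.card_univ, Fintype.card_fin] at h₁ h₂
    omega
  · intro i j hij
    by_contra! h
    simp only [Finset.mem_union, Finset.mem_image, Finset.mem_univ, true_and, not_or,
      not_exists] at h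
    obtain ⟨⟨hiu, hiw⟩, hju, hjw⟩ := h
    have hlarger : HasMatching G (matchNum G + 1) := by
      refine ⟨Fin.cons i u, Fin.cons j w, ?_, ?_, ?_, ?_⟩
      · exact Fin.cons_injective_iff.2 ⟨fun ⟨k, hk⟩ => hiu k hk, hu⟩
      · exact Fin.cons_injective_iff.2 ⟨fun ⟨k, hk⟩ => hjw k hk, hw⟩
      · intro a b
        refine Fin.cases ?_ (fun a => ?_) a <;> refine Fin.cases ?_ (fun b => ?_) b
        · simpa using hij.ne
        · simpa using fun h => hiw b h.symm
        · simpa using hju a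
        · simpa using huw a b
      · intro a
        refine Fin.cases ?_ (fun a => ?_) a
        · simpa using hij
        · simpa using hadj a
    have := le_csSup hbdd hlarger
    change matchNum G + 1 ≤ matchNum G at this
    omega

lemma graphKernel_eq_zero_of_mem_uncovered {n : ℕ} {G : SimpleGraph (Fin n)}
    {C : Finset (Fin n)} (hC : ∀ i j, G.Adj i j → i ∈ C ∨ j ∈ C) {x y : ℝ}
    (hx : x ∈ uncovered C) (hy : y ∈ uncovered C) : graphKernel n G x y = 0 := by
  refine if_neg ?_
  rintro ⟨i, j, hij, hxi, hyj⟩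
  rcases hC i j hij with h | h
  · exact hx.2 (mem_biUnion h hxi)
  · exact hy.2 (mem_biUnion h hyj)

lemma measureReal_compl_uncovered_le {n : ℕ} (C : Finset (Fin n)) :
    (volume.restrict (Set.Icc (0 : ℝ) 1)).real (uncovered C)ᶜ ≤ C.card / n := by
  rw [measureReal_restrict_apply (measurableSet_uncovered C).compl]
  have hsub : (uncovered C)ᶜ ∩ Set.Icc (0 : ℝ) 1 ⊆
      ⋃ i ∈ C, Set.Ioc ((i : ℝ) / n) (((i : ℝ) + 1) / n) := by
    rintro x ⟨hx, hx'⟩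
    by_contra h
    exact hx ⟨hx', h⟩
  have hfin : volume (⋃ i ∈ C, Set.Ioc ((i : ℝ) / n) (((i : ℝ) + 1) / n)) ≠ ⊤ :=
    (measure_biUnion_lt_top C.finite_toSet fun i _ => measure_Ioc_lt_top).ne
  refine (measureReal_mono hsub hfin).trans ((measureReal_biUnion_finset_le _ _).trans ?_)
  have (i : Fin n) : volume.real (Set.Ioc ((i : ℝ) / n) (((i : ℝ) + 1) / n)) = 1 / n := by
    rw [Real.volume_real_Ioc_of_le (by gcongr; linarith)]
    ring
  simp only [this, Finset.sum_const, nsmul_eq_mul]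
  rw [mul_one_div]

lemma integrable_graphKernel {n : ℕ} (G : SimpleGraph (Fin n)) (μ : Measure (ℝ × ℝ))
    [IsFiniteMeasure μ] : Integrable (fun q : ℝ × ℝ => graphKernel n G q.1 q.2) μ := by
  have hmeas : Measurable (fun q : ℝ × ℝ => graphKernel n G q.1 q.2) := by
    refine Measurable.ite ?_ measurable_const measurable_const
    simp only [ofPred_exists]
    refine .iUnion fun i => .iUnion fun j => .inter (.const _) (.inter ?_ ?_)
    · exact measurable_fst measurableSet_Ioc
    · exact measurable_snd measurableSet_Ioc
  refine .of_bound hmeas.aestronglyMeasurable n (ae_of_all _ fun q => ?_)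
  unfold graphKernel
  split_ifs <;> simp

/-- Iterated integrals over rectangles in `[0,1]²` are bounded by the cut norm. -/
lemma abs_setIntegral_le_cutNorm {W : ℝ → ℝ → ℝ}
    (hW : IntegrableOn (fun q : ℝ × ℝ => W q.1 q.2) (Set.Icc 0 1 ×ˢ Set.Icc 0 1))
    {S T : Set ℝ} (hS : MeasurableSet S) (hT : MeasurableSet T)
    (hSI : S ⊆ Set.Icc 0 1) (hTI : T ⊆ Set.Icc 0 1) :
    |∫ q in S ×ˢ T, W q.1 q.2| ≤ cutNorm W := by
  have hfubini {S T : Set ℝ} (hSI : S ⊆ Set.Icc 0 1) (hTI : T ⊆ Set.Icc 0 1) :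
      ∫ q in S ×ˢ T, W q.1 q.2 = ∫ x in S, ∫ y in T, W x y :=
    setIntegral_prod _ (hW.mono_set (prod_mono hSI hTI))
  refine le_csSup ⟨∫ q in Set.Icc (0 : ℝ) 1 ×ˢ Set.Icc (0 : ℝ) 1, |W q.1 q.2|, ?_⟩
    ⟨S, T, hS, hT, hSI, hTI, by rw [hfubini hSI hTI]⟩
  rintro _ ⟨S, T, hS, hT, hSI, hTI, rfl⟩
  rw [← hfubini hSI hTI]
  exact (abs_integral_le_integral_abs).trans
    (setIntegral_mono_set hW.abs (ae_of_all _ fun _ => abs_nonneg _)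
      (prod_mono hSI hTI).eventuallyLE)

/-- Truncations of an integrable function at large heights lose little mass. -/
lemma exists_integral_excess_lt {α : Type*} [MeasurableSpace α] {μ : Measure α} {f : α → ℝ}
    (hf : Integrable f μ) {ε : ℝ} (hε : 0 < ε) :
    ∃ K : ℕ, ∫ a, max (f a - K) 0 ∂μ < ε := by
  have hlim : Tendsto (fun K : ℕ => ∫ a, max (f a - K) 0 ∂μ) atTop (nhds (∫ _, 0 ∂μ)) := by
    refine tendsto_integral_of_dominated_convergence (fun a => |f a|) (fun K => ?_) hf.abs
      (fun K => ae_of_all _ fun a => ?_) (ae_of_all _ fun a => ?_)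
    · exact (hf.aestronglyMeasurable.sub aestronglyMeasurable_const).sup
        aestronglyMeasurable_const
    · rw [Real.norm_of_nonneg (le_max_right _ _)]
      have : (0 : ℝ) ≤ K := K.cast_nonneg
      exact max_le (by linarith [le_abs_self (f a)]) (abs_nonneg _)
    · refine tendsto_const_nhds.congr' ?_
      filter_upwards [eventually_ge_atTop ⌈f a⌉₊] with K hK
      exact (max_eq_right (sub_nonpos.2 (Nat.ceil_le.1 hK))).symm
  rw [integral_zero] at hlim
  exact (hlim.eventually (gt_mem_nhds hε)).exists

/-- The mass of an integrable function on a set is controlled by its excess over a height. -/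
lemma setIntegral_le_integral_excess_add {α : Type*} [MeasurableSpace α] {μ : Measure α}
    [IsFiniteMeasure μ] {f : α → ℝ} (hf : Integrable f μ) (s : Set α) (K : ℝ) :
    ∫ a in s, f a ∂μ ≤ ∫ a, max (f a - K) 0 ∂μ + K * μ.real s := by
  have hexc : Integrable (fun a => max (f a - K) 0) μ :=
    (hf.sub (integrable_const K)).pos_part
  calc ∫ a in s, f a ∂μ ≤ ∫ a in s, (max (f a - K) 0 + K) ∂μ :=
        integral_mono hf.integrableOn (hexc.integrableOn.add (integrable_const K)) fun a => by
          dsimp only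
          linarith [le_max_left (f a - K) 0]
    _ = ∫ a in s, max (f a - K) 0 ∂μ + K * μ.real s := by
        rw [integral_add hexc.integrableOn (integrable_const K), setIntegral_const,
          smul_eq_mul, mul_comm]
    _ ≤ _ := by
        exact add_le_add_left
          (setIntegral_le_integral hexc (ae_of_all _ fun _ => le_max_right _ _)) _

lemma isMPBij_id : IsMPBij id := ⟨bijOn_id _, .id _⟩

lemma measureReal_compl_prod_self_le {α : Type*} [MeasurableSpace α] (μ : Measure α)
    [IsProbabilityMeasure μ] (s : Set α) :
    (μ.prod μ).real (s ×ˢ s)ᶜ ≤ 2 * μ.real sᶜ := by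
  rw [compl_prod_eq_union]
  refine (measureReal_union_le _ _).trans ?_
  simp [measureReal_prod_prod, two_mul]

/-- With `p = 1/n`: let `κ` be a kernel (with `∫κ < ∞`), and `(G_n)`
graphs with `|G_n| = n` whose maximum matching has size `o(n)`.  Then
`liminf_{n→∞} d_□(κ_{G_n}, κ) ≥ ∫_{[0,1]²} κ`, i.e. for every `ε > 0`, eventually
`d_□(κ_{G_n}, κ) ≥ ∫κ − ε`. -/
theorem liminf_cutDist_ge_integral_of_small_matchings
    (κ : ℝ → ℝ → ℝ) (hκ : IsKernel κ)
    (G : ∀ n : ℕ, SimpleGraph (Fin n))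
    (hmatch : Tendsto (fun n : ℕ => (matchNum (G n) : ℝ) / n) atTop (nhds 0)) :
    ∀ ε : ℝ, 0 < ε → ∀ᶠ n in atTop,
      (∫ q in (Set.Icc (0:ℝ) 1 ×ˢ Set.Icc (0:ℝ) 1), Function.uncurry κ q) - ε ≤
        cutDist (graphKernel n (G n)) κ := by
  intro ε hε
  obtain ⟨hmeas, -, hnonneg, hint⟩ := hκ
  set I : Set ℝ := Set.Icc 0 1 with hI
  set μ : Measure ℝ := volume.restrict I with hμ
  have : IsProbabilityMeasure μ := ⟨by simp [hμ, hI]⟩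
  have hprod : (volume : Measure (ℝ × ℝ)).restrict (I ×ˢ I) = μ.prod μ := by
    rw [hμ, Measure.prod_restrict, Measure.volume_eq_prod]
  rw [IntegrableOn, hprod] at hint
  rw [hprod]
  obtain ⟨K, hK⟩ := exists_integral_excess_lt hint (half_pos hε)
  have hsmall : ∀ᶠ n in atTop, 4 * (K : ℝ) * ((matchNum (G n) : ℝ) / n) < ε / 2 := by
    have h := hmatch.const_mul (4 * (K : ℝ))
    rw [mul_zero] at h
    exact h.eventually (gt_mem_nhds (half_pos hε))
  filter_upwards [hsmall] with n hn
  refine le_csInf ⟨_, id, isMPBij_id, rfl⟩ ?_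
  rintro _ ⟨τ, ⟨-, hτ⟩, rfl⟩
  obtain ⟨C, hCcard, hC⟩ := exists_cover_card_le (G n)
  set B := uncovered C with hB
  have hBm : MeasurableSet B := measurableSet_uncovered C
  have hBI : B ⊆ I := sdiff_subset
  have hττ : MeasurePreserving (Prod.map τ τ) (μ.prod μ) (μ.prod μ) := hτ.prod hτ
  have hτint : Integrable (Function.uncurry κ ∘ Prod.map τ τ) (μ.prod μ) :=
    hττ.integrable_comp_of_integrable hint
  have hτeq (g : ℝ × ℝ → ℝ) (hg : Measurable g) :
      ∫ q, g (Prod.map τ τ q) ∂μ.prod μ = ∫ q, g q ∂μ.prod μ := by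
    conv_rhs => rw [← hττ.map_eq]
    exact (integral_map hττ.aemeasurable hg.aestronglyMeasurable).symm
  have hcut : ∫ q in B ×ˢ B, (Function.uncurry κ ∘ Prod.map τ τ) q ∂μ.prod μ ≤
      cutNorm (fun x y => graphKernel n (G n) x y - κ (τ x) (τ y)) := by
    refine le_trans (le_of_eq ?_) (abs_setIntegral_le_cutNorm ?_ hBm hBm hBI hBI)
    · have hneg : ∫ q in B ×ˢ B, (graphKernel n (G n) q.1 q.2 - κ (τ q.1) (τ q.2)) =
          -∫ q in B ×ˢ B, κ (τ q.1) (τ q.2) := by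
        rw [← integral_neg]
        refine setIntegral_congr_fun (hBm.prod hBm) fun q hq => ?_
        simp [graphKernel_eq_zero_of_mem_uncovered hC hq.1 hq.2]
      rw [hneg, abs_neg, abs_of_nonneg (integral_nonneg fun _ => hnonneg _ _), ← hprod,
        Measure.restrict_restrict (hBm.prod hBm), inter_eq_left.2 (prod_mono hBI hBI)]
      rfl
    · rw [IntegrableOn, hprod]
      exact (integrable_graphKernel (G n) _).sub hτint
  have hsplit := integral_add_compl (hBm.prod hBm) hτint
  have htotal : ∫ q, (Function.uncurry κ ∘ Prod.map τ τ) q ∂μ.prod μ =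
      ∫ q, Function.uncurry κ q ∂μ.prod μ := hτeq _ hmeas
  have hexc : ∫ q, max ((Function.uncurry κ ∘ Prod.map τ τ) q - K) 0 ∂μ.prod μ =
      ∫ q, max (Function.uncurry κ q - K) 0 ∂μ.prod μ :=
    hτeq (fun q => max (Function.uncurry κ q - K) 0)
      ((hmeas.sub measurable_const).max measurable_const)
  have hcompl := setIntegral_le_integral_excess_add hτint (B ×ˢ B)ᶜ K
  have hvol : (μ.prod μ).real (B ×ˢ B)ᶜ ≤ 4 * ((matchNum (G n) : ℝ) / n) := by
    refine (measureReal_compl_prod_self_le μ B).trans ?_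
    have h₁ : μ.real Bᶜ ≤ C.card / n := measureReal_compl_uncovered_le C
    have h₂ : (C.card : ℝ) / n ≤ 2 * (matchNum (G n) : ℝ) / n := by
      gcongr
      exact_mod_cast hCcard
    rw [mul_div_assoc] at h₂
    linarith
  have hKvol := mul_le_mul_of_nonneg_left hvol (K.cast_nonneg (α := ℝ))
  linarith
end
end

section
/- Fix p = 1/n. For every kernel κ with ∫κ < ∞ and every constant c > 0 there exists n₀ such that for every n ≥ n₀ and every graph G on n vertices containing a matching of size at least cn, the cut distance satisfies d_□(κ_G, κ) > c/25. -/
open MeasureTheory Set Filter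

noncomputable section
open scoped Classical

/-- The interval `I_i` of `graphKernel`. -/
def vertexInterval (n : ℕ) (i : Fin n) : Set ℝ :=
  Set.Ioc ((i : ℝ) / n) (((i : ℝ) + 1) / n)

lemma measurableSet_vertexInterval (n : ℕ) (i : Fin n) :
    MeasurableSet (vertexInterval n i) := measurableSet_Ioc

lemma vertexInterval_subset (n : ℕ) (i : Fin n) : vertexInterval n i ⊆ Set.Icc 0 1 := by
  rintro x ⟨h1, h2⟩
  have hn : (0 : ℝ) < n := by exact_mod_cast i.pos
  have hi : ((i : ℝ) + 1) ≤ n := by exact_mod_cast i.isLt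
  exact ⟨(by positivity : (0 : ℝ) ≤ (i : ℝ) / n).trans h1.le,
    h2.trans ((div_le_one hn).2 hi)⟩

lemma volume_vertexInterval (n : ℕ) (i : Fin n) :
    volume (vertexInterval n i) = ENNReal.ofReal (1 / n) := by
  rw [vertexInterval, Real.volume_Ioc]
  congr 1
  ring

lemma disjoint_vertexInterval {n : ℕ} {i j : Fin n} (hij : i ≠ j) :
    Disjoint (vertexInterval n i) (vertexInterval n j) := by
  have hn : (0 : ℝ) < n := by exact_mod_cast i.pos
  rw [Set.disjoint_left]
  rintro x ⟨h1, h2⟩ ⟨h3, h4⟩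
  rw [div_lt_iff₀ hn] at h1 h3
  rw [le_div_iff₀ hn] at h2 h4
  have h5 : (i : ℝ) < j + 1 := h1.trans_le h4
  have h6 : (j : ℝ) < i + 1 := h3.trans_le h2
  have h7 : (i : ℕ) < j + 1 := by exact_mod_cast h5
  have h8 : (j : ℕ) < i + 1 := by exact_mod_cast h6
  exact hij (Fin.ext (by omega))

lemma graphKernel_eq_of_adj {n : ℕ} {G : SimpleGraph (Fin n)} {i j : Fin n} (h : G.Adj i j)
    {x y : ℝ} (hx : x ∈ vertexInterval n i) (hy : y ∈ vertexInterval n j) :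
    graphKernel n G x y = n :=
  if_pos ⟨i, j, h, hx, hy⟩

lemma measurable_graphKernel (n : ℕ) (G : SimpleGraph (Fin n)) :
    Measurable (Function.uncurry (graphKernel n G)) := by
  refine Measurable.ite (p := fun z : ℝ × ℝ => ∃ i j : Fin n, G.Adj i j ∧
    z.1 ∈ vertexInterval n i ∧ z.2 ∈ vertexInterval n j) ?_ measurable_const measurable_const
  simp only [Set.ofPred_exists]
  refine MeasurableSet.iUnion fun i => MeasurableSet.iUnion fun j => ?_
  exact (MeasurableSet.const _).inter
    ((measurableSet_vertexInterval n i).prod (measurableSet_vertexInterval n j))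

lemma abs_graphKernel_le (n : ℕ) (G : SimpleGraph (Fin n)) (x y : ℝ) :
    |graphKernel n G x y| ≤ n := by
  unfold graphKernel
  split_ifs <;> simp

lemma integrableOn_graphKernel (n : ℕ) (G : SimpleGraph (Fin n)) :
    IntegrableOn (Function.uncurry (graphKernel n G)) (Set.Icc 0 1 ×ˢ Set.Icc 0 1) := by
  refine Measure.integrableOn_of_bounded (M := n) ?_
    (measurable_graphKernel n G).aestronglyMeasurable
    (Eventually.of_forall fun z => abs_graphKernel_le n G z.1 z.2)
  exact (isCompact_Icc.prod isCompact_Icc).measure_lt_top.ne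

lemma measurePreserving_prodMap {τ : ℝ → ℝ} (hτ : IsMPBij τ) :
    MeasurePreserving (Prod.map τ τ)
      (volume.restrict (Set.Icc (0 : ℝ) 1 ×ˢ Set.Icc (0 : ℝ) 1))
      (volume.restrict (Set.Icc (0 : ℝ) 1 ×ˢ Set.Icc (0 : ℝ) 1)) := by
  rw [Measure.volume_eq_prod, ← Measure.prod_restrict]
  exact hτ.2.prod hτ.2

lemma abs_setIntegral_prod_le_cutNorm {W : ℝ → ℝ → ℝ}
    (hW : IntegrableOn (Function.uncurry W) (Set.Icc 0 1 ×ˢ Set.Icc 0 1))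
    {S T : Set ℝ} (hS : MeasurableSet S) (hT : MeasurableSet T)
    (hS' : S ⊆ Set.Icc 0 1) (hT' : T ⊆ Set.Icc 0 1) :
    |∫ z in S ×ˢ T, Function.uncurry W z| ≤ cutNorm W := by
  have key : ∀ {S T : Set ℝ}, S ⊆ Set.Icc 0 1 → T ⊆ Set.Icc 0 1 →
      ∫ x in S, ∫ y in T, W x y = ∫ z in S ×ˢ T, Function.uncurry W z := by
    intro S T hS' hT'
    exact (setIntegral_prod _ (hW.mono_set (Set.prod_mono hS' hT'))).symm
  refine le_csSup ?_ ⟨S, T, hS, hT, hS', hT', by rw [key hS' hT']⟩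
  refine ⟨∫ z in Set.Icc (0 : ℝ) 1 ×ˢ Set.Icc (0 : ℝ) 1, ‖Function.uncurry W z‖, ?_⟩
  rintro r ⟨S, T, hS, hT, hS', hT', rfl⟩
  rw [key hS' hT']
  refine (norm_integral_le_integral_norm (G := ℝ) _).trans ?_
  exact setIntegral_mono_set hW.norm (Eventually.of_forall fun z => norm_nonneg _)
    (Set.prod_mono hS' hT').eventuallyLE

/-- Summing a linear form over all subsets: every element is in half of them. -/
lemma two_mul_sum_powerset_sum {ι : Type*} [DecidableEq ι] (b : ι → ℝ) (s : Finset ι) :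
    2 * ∑ A ∈ s.powerset, ∑ i ∈ A, b i = 2 ^ s.card * ∑ i ∈ s, b i := by
  induction s using Finset.induction_on with
  | empty => simp
  | insert k s hk ih =>
    have h : ∀ A ∈ s.powerset, ∑ i ∈ insert k A, b i = b k + ∑ i ∈ A, b i := fun A hA =>
      Finset.sum_insert fun hkA => hk (Finset.mem_powerset.1 hA hkA)
    rw [Finset.sum_powerset_insert hk, Finset.sum_congr rfl h, Finset.sum_add_distrib,
      Finset.sum_const, Finset.card_powerset, Finset.card_insert_of_notMem hk,
      Finset.sum_insert hk, nsmul_eq_mul]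
    push_cast
    linear_combination 2 * ih

/-- Summing a bilinear form over all squares `A × A`: a diagonal entry is in half of them,
any other entry in a quarter. -/
lemma four_mul_sum_powerset_sum_sum {ι : Type*} [DecidableEq ι] (a : ι → ι → ℝ) (s : Finset ι) :
    4 * ∑ A ∈ s.powerset, ∑ i ∈ A, ∑ j ∈ A, a i j
      = 2 ^ s.card * (∑ i ∈ s, ∑ j ∈ s, a i j + ∑ i ∈ s, a i i) := by
  induction s using Finset.induction_on with
  | empty => simp
  | insert k s hk ih =>
    have expand : ∀ A : Finset ι, k ∉ A → ∑ i ∈ insert k A, ∑ j ∈ insert k A, a i j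
        = a k k + ∑ i ∈ A, (a k i + a i k) + ∑ i ∈ A, ∑ j ∈ A, a i j := by
      intro A hA
      rw [Finset.sum_insert hA, Finset.sum_insert hA]
      simp only [Finset.sum_insert hA, Finset.sum_add_distrib]
      ring
    have h : ∀ A ∈ s.powerset, ∑ i ∈ insert k A, ∑ j ∈ insert k A, a i j
        = a k k + ∑ i ∈ A, (a k i + a i k) + ∑ i ∈ A, ∑ j ∈ A, a i j := fun A hA =>
      expand A fun hkA => hk (Finset.mem_powerset.1 hA hkA)
    have h2 := two_mul_sum_powerset_sum (fun i => a k i + a i k) s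
    rw [Finset.sum_powerset_insert hk, Finset.sum_congr rfl h, Finset.sum_add_distrib,
      Finset.sum_add_distrib, Finset.sum_const, Finset.card_powerset,
      Finset.card_insert_of_notMem hk, expand s hk, Finset.sum_insert hk, nsmul_eq_mul]
    push_cast
    linear_combination 2 * ih + 2 * h2

lemma sum_diag_le_of_abs_sum_le {ι : Type*} [Fintype ι] (a : ι → ι → ℝ) {δ : ℝ}
    (h : ∀ A : Finset ι, |∑ i ∈ A, ∑ j ∈ A, a i j| ≤ δ) :
    ∑ i, a i i ≤ 5 * δ := by
  have h1 := four_mul_sum_powerset_sum_sum a Finset.univ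
  have h2 : ∑ A ∈ (Finset.univ : Finset ι).powerset, ∑ i ∈ A, ∑ j ∈ A, a i j
      ≤ 2 ^ (Finset.univ : Finset ι).card * δ := by
    refine (Finset.sum_le_card_nsmul _ _ δ fun A _ => (le_abs_self _).trans (h A)).trans ?_
    rw [Finset.card_powerset, nsmul_eq_mul]
    push_cast
    exact le_rfl
  have h3 := (abs_le.1 (h Finset.univ)).1
  have hp : (0 : ℝ) < 2 ^ (Finset.univ : Finset ι).card := by positivity
  have h4 : ∑ i, ∑ j, a i j + ∑ i, a i i ≤ 4 * δ := by
    refine le_of_mul_le_mul_left ?_ hp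
    linarith
  linarith

/-- The blocks of an integrable `W` paired up by two injections `u`, `w` contribute in total
at most five times the cut norm. -/
lemma sum_setIntegral_le_cutNorm {W : ℝ → ℝ → ℝ}
    (hW : IntegrableOn (Function.uncurry W) (Set.Icc 0 1 ×ˢ Set.Icc 0 1))
    {n m : ℕ} {u w : Fin m → Fin n} (hu : Function.Injective u) (hw : Function.Injective w) :
    ∑ i, ∫ z in vertexInterval n (u i) ×ˢ vertexInterval n (w i), Function.uncurry W z
      ≤ 5 * cutNorm W := by
  refine sum_diag_le_of_abs_sum_le (fun i j => ∫ z in vertexInterval n (u i) ×ˢ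
    vertexInterval n (w j), Function.uncurry W z) fun A => ?_
  have hset : (⋃ i ∈ A, vertexInterval n (u i)) ×ˢ (⋃ i ∈ A, vertexInterval n (w i))
      = ⋃ p ∈ A ×ˢ A, vertexInterval n (u p.1) ×ˢ vertexInterval n (w p.2) := by
    ext z
    simp only [Set.mem_prod, Set.mem_iUnion, Finset.mem_product, exists_prop, Prod.exists]
    constructor
    · rintro ⟨⟨i, hi, hi'⟩, j, hj, hj'⟩
      exact ⟨i, j, ⟨hi, hj⟩, hi', hj'⟩
    · rintro ⟨i, j, ⟨hi, hj⟩, hi', hj'⟩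
      exact ⟨⟨i, hi, hi'⟩, j, hj, hj'⟩
  have hle := abs_setIntegral_prod_le_cutNorm hW
    (S := ⋃ i ∈ A, vertexInterval n (u i)) (T := ⋃ i ∈ A, vertexInterval n (w i))
    (Finset.measurableSet_biUnion _ fun i _ => measurableSet_vertexInterval n _)
    (Finset.measurableSet_biUnion _ fun i _ => measurableSet_vertexInterval n _)
    (Set.iUnion₂_subset fun i _ => vertexInterval_subset n _)
    (Set.iUnion₂_subset fun i _ => vertexInterval_subset n _)
  rw [hset, integral_biUnion_finset] at hle
  · rwa [Finset.sum_product] at hle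
  · exact fun p _ => (measurableSet_vertexInterval n _).prod (measurableSet_vertexInterval n _)
  · intro p _ q _ hpq
    rw [Function.onFun, Set.disjoint_prod]
    by_cases h1 : p.1 = q.1
    · exact Or.inr (disjoint_vertexInterval fun h => hpq (Prod.ext h1 (hw h)))
    · exact Or.inl (disjoint_vertexInterval fun h => h1 (hu h))
  · exact fun p _ => hW.mono_set
      (Set.prod_mono (vertexInterval_subset n _) (vertexInterval_subset n _))

lemma tendsto_integral_sub_min {α : Type*} [MeasurableSpace α] {μ : Measure α} {f : α → ℝ}
    (hf : Integrable f μ) (hf0 : ∀ x, 0 ≤ f x) :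
    Tendsto (fun K : ℕ => ∫ x, (f x - min (f x) K) ∂μ) atTop (nhds 0) := by
  have h := tendsto_integral_of_dominated_convergence (μ := μ)
    (F := fun (K : ℕ) x => f x - min (f x) K) (f := fun _ => (0 : ℝ)) f
    (fun K => hf.aestronglyMeasurable.sub
      (hf.aestronglyMeasurable.inf aestronglyMeasurable_const)) hf ?_ ?_
  · simpa using h
  · intro K
    refine Eventually.of_forall fun x => ?_
    have hK : (0 : ℝ) ≤ min (f x) K := le_min (hf0 x) K.cast_nonneg
    rw [Real.norm_eq_abs, abs_of_nonneg (sub_nonneg.2 (min_le_left _ _))]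
    linarith
  · refine Eventually.of_forall fun x => ?_
    obtain ⟨N, hN⟩ := exists_nat_ge (f x)
    refine tendsto_const_nhds.congr' ?_
    filter_upwards [eventually_ge_atTop N] with K hK
    rw [min_eq_left (hN.trans (by exact_mod_cast hK)), sub_self]

/-- Uniform integrability of a measure-preserving rearrangement `f ∘ T`, uniformly in `T`. -/
lemma setIntegral_comp_le {α : Type*} [MeasurableSpace α] {μ : Measure α} [IsFiniteMeasure μ]
    {f : α → ℝ} (hf : Integrable f μ) {T : α → α} (hT : MeasurePreserving T μ μ)
    (K : ℝ) (E : Set α) :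
    ∫ x in E, f (T x) ∂μ ≤ ∫ x, (f x - min (f x) K) ∂μ + K * μ.real E := by
  have hg : Integrable (fun x => f x - min (f x) K) μ := hf.sub (hf.inf (integrable_const K))
  have hgT : Integrable (fun x => f (T x) - min (f (T x)) K) μ :=
    hT.integrable_comp_of_integrable hg
  have hfT : Integrable (fun x => f (T x)) μ := hT.integrable_comp_of_integrable hf
  have h1 : ∫ x, (f (T x) - min (f (T x)) K) ∂μ = ∫ x, (f x - min (f x) K) ∂μ := by
    conv_rhs => rw [← hT.map_eq]
    refine (integral_map (f := fun x => f x - min (f x) K) hT.measurable.aemeasurable ?_).symm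
    rw [hT.map_eq]
    exact hg.aestronglyMeasurable
  calc ∫ x in E, f (T x) ∂μ
      ≤ ∫ x in E, ((f (T x) - min (f (T x)) K) + K) ∂μ := by
        refine integral_mono hfT.integrableOn
          (hgT.integrableOn.add (integrable_const K)) fun x => ?_
        have := min_le_right (f (T x)) K
        dsimp only
        linarith
    _ = ∫ x in E, (f (T x) - min (f (T x)) K) ∂μ + K * μ.real E := by
        rw [integral_add hgT.integrableOn (integrable_const K), setIntegral_const, smul_eq_mul,
          mul_comm K]
    _ ≤ _ := by
        rw [← h1]
        refine add_le_add_left (setIntegral_le_integral hgT ?_) _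
        exact (Eventually.of_forall fun x => sub_nonneg.2 (min_le_left _ _))

lemma volume_real_vertexInterval_prod (n : ℕ) (i j : Fin n) :
    volume.real (vertexInterval n i ×ˢ vertexInterval n j) = 1 / n * (1 / n) := by
  rw [Measure.volume_eq_prod, measureReal_prod_prod, measureReal_def, measureReal_def,
    volume_vertexInterval, volume_vertexInterval, ENNReal.toReal_ofReal (by positivity)]

/-- Up to a truncation error of `κ`, a graph with a matching of size `m` differs from any
rearrangement of `κ` by at least `m / (5 n)` in cut norm. -/
lemma le_cutNorm_of_matching {κ : ℝ → ℝ → ℝ} (hκ : IsKernel κ) {τ : ℝ → ℝ} (hτ : IsMPBij τ)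
    {n m : ℕ} (hn : 0 < n) {G : SimpleGraph (Fin n)} (hm : HasMatching G m) {K : ℝ} (hK : 0 ≤ K) :
    (m : ℝ) / n - ((∫ z in Set.Icc (0 : ℝ) 1 ×ˢ Set.Icc (0 : ℝ) 1,
      (Function.uncurry κ z - min (Function.uncurry κ z) K)) + K / n)
      ≤ 5 * cutNorm (fun x y => graphKernel n G x y - κ (τ x) (τ y)) := by
  obtain ⟨u, w, hu, hw, -, hadj⟩ := hm
  have hn' : (0 : ℝ) < n := by exact_mod_cast hn
  have hmn : (m : ℝ) ≤ n := by
    have := Fintype.card_le_of_injective u hu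
    simp only [Fintype.card_fin] at this
    exact_mod_cast this
  set Q : Set (ℝ × ℝ) := Set.Icc (0 : ℝ) 1 ×ˢ Set.Icc (0 : ℝ) 1 with hQ
  have : IsFiniteMeasure (volume.restrict Q) :=
    isFiniteMeasure_restrict.2 (isCompact_Icc.prod isCompact_Icc).measure_lt_top.ne
  set E : Fin m → Set (ℝ × ℝ) := fun i => vertexInterval n (u i) ×ˢ vertexInterval n (w i) with hE
  have hEm : ∀ i, MeasurableSet (E i) := fun i =>
    (measurableSet_vertexInterval n _).prod (measurableSet_vertexInterval n _)
  have hEQ : ∀ i, E i ⊆ Q := fun i =>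
    Set.prod_mono (vertexInterval_subset n _) (vertexInterval_subset n _)
  have hEd : Pairwise (Function.onFun Disjoint E) := fun i j hij =>
    Set.disjoint_prod.2 (Or.inl (disjoint_vertexInterval (hu.ne hij)))
  have hT := measurePreserving_prodMap hτ
  have hκτ : IntegrableOn (fun z : ℝ × ℝ => Function.uncurry κ (Prod.map τ τ z)) Q :=
    hT.integrable_comp_of_integrable hκ.2.2.2
  have hG := integrableOn_graphKernel n G
  have hmain := sum_setIntegral_le_cutNorm
    (W := fun x y => graphKernel n G x y - κ (τ x) (τ y)) (hG.sub hκτ) hu hw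
  have hsplit : ∀ i, ∫ z in E i, Function.uncurry
      (fun x y => graphKernel n G x y - κ (τ x) (τ y)) z
      = 1 / n - ∫ z in E i, Function.uncurry κ (Prod.map τ τ z) := by
    intro i
    have h1 : ∫ z in E i, Function.uncurry (graphKernel n G) z = 1 / n := by
      rw [setIntegral_congr_fun (f := Function.uncurry (graphKernel n G)) (hEm i)
        (g := fun _ => (n : ℝ)) fun z hz => graphKernel_eq_of_adj (hadj i) hz.1 hz.2,
        setIntegral_const, volume_real_vertexInterval_prod, smul_eq_mul]
      field_simp
    rw [← h1]
    exact integral_sub (hG.mono_set (hEQ i)) (hκτ.mono_set (hEQ i))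
  have hsum : ∑ i, ∫ z in E i, Function.uncurry κ (Prod.map τ τ z)
      = ∫ z in ⋃ i, E i, Function.uncurry κ (Prod.map τ τ z) ∂(volume.restrict Q) := by
    rw [Measure.restrict_restrict (MeasurableSet.iUnion hEm),
      Set.inter_eq_left.2 (Set.iUnion_subset hEQ),
      integral_iUnion_fintype hEm hEd fun i => hκτ.mono_set (hEQ i)]
  have hvol : (volume.restrict Q).real (⋃ i, E i) ≤ 1 / n := by
    refine (measureReal_iUnion_fintype_le _).trans ?_
    have hle : ∀ i ∈ Finset.univ, (volume.restrict Q).real (E i) ≤ 1 / n * (1 / n) := by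
      intro i _
      rw [measureReal_restrict_apply (hEm i), Set.inter_eq_left.2 (hEQ i),
        volume_real_vertexInterval_prod]
    refine (Finset.sum_le_card_nsmul _ _ _ hle).trans ?_
    rw [Finset.card_univ, Fintype.card_fin, nsmul_eq_mul]
    calc (m : ℝ) * (1 / n * (1 / n)) ≤ n * (1 / n * (1 / n)) := by gcongr
      _ = 1 / n := by field_simp
  have hui := setIntegral_comp_le (μ := volume.restrict Q) hκ.2.2.2 hT K (⋃ i, E i)
  rw [← hsum] at hui
  have hKn : K * (volume.restrict Q).real (⋃ i, E i) ≤ K / n := by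
    rw [div_eq_mul_one_div]
    gcongr
  rw [Finset.sum_congr rfl fun i _ => hsplit i, Finset.sum_sub_distrib, Finset.sum_const,
    Finset.card_univ, Fintype.card_fin, nsmul_eq_mul, mul_one_div] at hmain
  linarith

/-- With `p = 1/n`: for every kernel `κ` (with `∫κ < ∞`) and every
constant `c > 0` there is `n₀` such that for every `n ≥ n₀` and every graph `G` on `n`
vertices containing a matching of size at least `cn`, we have `d_□(κ_G, κ) > c/25`. -/
theorem cutDist_gt_of_large_matching
    (κ : ℝ → ℝ → ℝ) (hκ : IsKernel κ) (c : ℝ) (hc : 0 < c) :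
    ∃ n₀ : ℕ, ∀ n, n₀ ≤ n → ∀ G : SimpleGraph (Fin n),
      (∃ m : ℕ, c * n ≤ (m : ℝ) ∧ HasMatching G m) →
        c / 25 < cutDist (graphKernel n G) κ := by
  obtain ⟨K, hK⟩ := ((tendsto_integral_sub_min hκ.2.2.2
    fun z => hκ.2.2.1 z.1 z.2).eventually_lt_const (by positivity : (0 : ℝ) < c / 4)).exists
  obtain ⟨N, hN⟩ := exists_nat_ge ((K : ℝ) / (c / 4))
  refine ⟨N + 1, fun n hn G ⟨m, hcm, hm⟩ => ?_⟩
  have hn0 : 0 < n := by omega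
  have hn' : (0 : ℝ) < n := by exact_mod_cast hn0
  have hKn : (K : ℝ) / n ≤ c / 4 := by
    have hNn : (N : ℝ) ≤ n := by exact_mod_cast (Nat.le_succ N).trans hn
    rw [div_le_iff₀ (by positivity)] at hN
    rw [div_le_iff₀ hn']
    nlinarith
  have hmn : c ≤ (m : ℝ) / n := (le_div_iff₀ hn').2 hcm
  have hlow : c / 10 ≤ cutDist (graphKernel n G) κ := by
    refine le_csInf ⟨_, id, isMPBij_id, rfl⟩ ?_
    rintro r ⟨τ, hτ, rfl⟩
    have := le_cutNorm_of_matching hκ hτ hn0 hm (K.cast_nonneg (α := ℝ))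
    linarith
  linarith
end
end
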